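/- Let a, a' ∈ ℝ, m ∈ ℕ, m' ∈ ℕ₀ and 0 ≤ ℓ < d. (i) For 1 < p < ∞, 𝒦^m_{a,p}(ℝ^d,ℝ^ℓ_*) is continuously embedded into 𝒦^{m'}_{a',∞}(ℝ^d,ℝ^ℓ_*) if, and only if, m − d/p > m' and a − d/p ≥ a'. (ii) For p = 1, 𝒦^m_{a,1}(ℝ^d,ℝ^ℓ_*) is continuously embedded into 𝒦^{m'}_{a',∞}(ℝ^d,ℝ^ℓ_*) if, and only if, m − d ≥ m' and a − d ≥ a'. -/

import Mathlib

open MeasureTheory Metric Set Filter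
open scoped Topology ENNReal NNReal

noncomputable section

/-- `d`-dimensional Euclidean space. -/
abbrev Ed (d : ℕ) : Type := EuclideanSpace ℝ (Fin d)

/-- The finite set of all multi-indices `α : Fin d → ℕ` with `|α| = ∑ i, α i ≤ m`. -/
def multiIdx (d m : ℕ) : Finset (Fin d → ℕ) :=
  (Fintype.piFinset fun _ : Fin d => Finset.range (m + 1)).filter fun α => ∑ i, α i ≤ m

/-- First-order partial derivative in the `i`-th coordinate direction. -/
def pderivI (d : ℕ) (i : Fin d) (f : Ed d → ℝ) : Ed d → ℝ :=
  fun x => fderiv ℝ f x (EuclideanSpace.single i 1)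

/-- Iterated partial derivative `∂^α`. -/
def pderivA (d : ℕ) (α : Fin d → ℕ) (f : Ed d → ℝ) : Ed d → ℝ :=
  ((List.finRange d).foldr (fun i g => (pderivI d i)^[α i] ∘ g) id) f

/-- Smooth compactly supported test functions with support inside `Ω`. -/
def IsTestFun (d : ℕ) (Ω : Set (Ed d)) (φ : Ed d → ℝ) : Prop :=
  ContDiff ℝ (⊤ : ℕ∞) φ ∧ HasCompactSupport φ ∧ tsupport φ ⊆ Ω

/-- `v` is the `α`-th weak (distributional) derivative of `u` on `Ω`. -/
def HasWeakDerivOn (d : ℕ) (Ω : Set (Ed d)) (α : Fin d → ℕ) (u v : Ed d → ℝ) : Prop :=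
  LocallyIntegrableOn u Ω volume ∧ LocallyIntegrableOn v Ω volume ∧
    ∀ φ : Ed d → ℝ, IsTestFun d Ω φ →
      ∫ x in Ω, u x * pderivA d α φ x = (-1 : ℝ) ^ (∑ i, α i) * ∫ x in Ω, v x * φ x

/-- `D` is a family of weak derivatives of `u` on `Ω` for all multi-indices of order `≤ m`. -/
def IsWeakDerivFamily (d : ℕ) (Ω : Set (Ed d)) (m : ℕ) (u : Ed d → ℝ)
    (D : (Fin d → ℕ) → Ed d → ℝ) : Prop :=
  ∀ α ∈ multiIdx d m, HasWeakDerivOn d Ω α u (D α)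

/-- `x ↦ (ρ(x)^(|α|-a) |v(x)|)^p`, the integrand in the Kondratiev norm. -/
def kIntegrand (d : ℕ) (ρ : Ed d → ℝ) (a p : ℝ) (α : Fin d → ℕ) (v : Ed d → ℝ) : Ed d → ℝ :=
  fun x => (ρ x ^ (((∑ i, α i : ℕ) : ℝ) - a) * |v x|) ^ p

/-- The Kondratiev norm computed from a family `D` of weak derivatives. -/
def KnormP (d : ℕ) (Ω : Set (Ed d)) (ρ : Ed d → ℝ) (m : ℕ) (a p : ℝ)
    (D : (Fin d → ℕ) → Ed d → ℝ) : ℝ :=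
  (∑ α ∈ multiIdx d m, ∫ x in Ω, kIntegrand d ρ a p α (D α) x) ^ (1 / p)

/-- `D` witnesses membership of `u` in the Kondratiev space `𝒦^m_{a,p}(Ω, M)`
    (with weight function `ρ`). -/
def KMemData (d : ℕ) (Ω : Set (Ed d)) (ρ : Ed d → ℝ) (m : ℕ) (a p : ℝ)
    (u : Ed d → ℝ) (D : (Fin d → ℕ) → Ed d → ℝ) : Prop :=
  IsWeakDerivFamily d Ω m u D ∧
    ∀ α ∈ multiIdx d m, IntegrableOn (kIntegrand d ρ a p α (D α)) Ω volume

/-- Membership in the Kondratiev space `𝒦^m_{a,p}(Ω, M)` with weight `ρ`, `p < ∞`. -/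
def MemK (d : ℕ) (Ω : Set (Ed d)) (ρ : Ed d → ℝ) (m : ℕ) (a p : ℝ) (u : Ed d → ℝ) : Prop :=
  ∃ D, KMemData d Ω ρ m a p u D

open Classical in
/-- The Kondratiev norm of `u` (computed from a choice of weak derivative family;
    it is a.e. independent of this choice). -/
def Knorm (d : ℕ) (Ω : Set (Ed d)) (ρ : Ed d → ℝ) (m : ℕ) (a p : ℝ) (u : Ed d → ℝ) : ℝ :=
  if h : MemK d Ω ρ m a p u then KnormP d Ω ρ m a p h.choose else 0

/-- `x ↦ ρ(x)^(|α|-a) v(x)`, the function whose `L_∞` norm enters the norm for `p = ∞`. -/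
def kIntegrandInf (d : ℕ) (ρ : Ed d → ℝ) (a : ℝ) (α : Fin d → ℕ) (v : Ed d → ℝ) : Ed d → ℝ :=
  fun x => ρ x ^ (((∑ i, α i : ℕ) : ℝ) - a) * v x

/-- `D` witnesses membership of `u` in `𝒦^m_{a,∞}(Ω, M)`. -/
def KMemDataInf (d : ℕ) (Ω : Set (Ed d)) (ρ : Ed d → ℝ) (m : ℕ) (a : ℝ)
    (u : Ed d → ℝ) (D : (Fin d → ℕ) → Ed d → ℝ) : Prop :=
  IsWeakDerivFamily d Ω m u D ∧
    ∀ α ∈ multiIdx d m,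
      eLpNorm (kIntegrandInf d ρ a α (D α)) ⊤ (volume.restrict Ω) < ⊤

/-- Membership in `𝒦^m_{a,∞}(Ω, M)`. -/
def MemKInf (d : ℕ) (Ω : Set (Ed d)) (ρ : Ed d → ℝ) (m : ℕ) (a : ℝ) (u : Ed d → ℝ) : Prop :=
  ∃ D, KMemDataInf d Ω ρ m a u D

/-- The `𝒦^m_{a,∞}` norm computed from a family `D` of weak derivatives. -/
def KnormInfP (d : ℕ) (Ω : Set (Ed d)) (ρ : Ed d → ℝ) (m : ℕ) (a : ℝ)
    (D : (Fin d → ℕ) → Ed d → ℝ) : ℝ :=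
  ∑ α ∈ multiIdx d m, (eLpNorm (kIntegrandInf d ρ a α (D α)) ⊤ (volume.restrict Ω)).toReal

open Classical in
/-- The `𝒦^m_{a,∞}(Ω, M)` norm of `u`. -/
def KnormInf (d : ℕ) (Ω : Set (Ed d)) (ρ : Ed d → ℝ) (m : ℕ) (a : ℝ) (u : Ed d → ℝ) : ℝ :=
  if h : MemKInf d Ω ρ m a u then KnormInfP d Ω ρ m a h.choose else 0

/-- The subspace `ℝ^ℓ_* = {x : x₁ = ⋯ = x_{d-ℓ} = 0}` of `ℝ^d`. -/
def RStar (d ℓ : ℕ) : Set (Ed d) := {x | ∀ i : Fin d, (i : ℕ) < d - ℓ → x i = 0}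

/-- The weight `ρ(x) = min(1, |x'|)` for the model case `(ℝ^d, ℝ^ℓ_*)`. -/
def rhoModel (d ℓ : ℕ) (x : Ed d) : ℝ :=
  min 1 (Real.sqrt (∑ i ∈ Finset.univ.filter (fun i : Fin d => (i : ℕ) < d - ℓ), (x i) ^ 2))

/-- The model domain `ℝ^d ∖ ℝ^ℓ_*`. -/
def ModelDomain (d ℓ : ℕ) : Set (Ed d) := (RStar d ℓ)ᶜ

/-- Membership in the model Kondratiev space `𝒦^m_{a,p}(ℝ^d, ℝ^ℓ_*)`, `p < ∞`. -/
def MemKM (d ℓ m : ℕ) (a p : ℝ) (u : Ed d → ℝ) : Prop :=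
  MemK d (ModelDomain d ℓ) (rhoModel d ℓ) m a p u

/-- The norm of the model Kondratiev space `𝒦^m_{a,p}(ℝ^d, ℝ^ℓ_*)`, `p < ∞`. -/
def KnormM (d ℓ m : ℕ) (a p : ℝ) (u : Ed d → ℝ) : ℝ :=
  Knorm d (ModelDomain d ℓ) (rhoModel d ℓ) m a p u

/-- Membership in the model Kondratiev space `𝒦^m_{a,∞}(ℝ^d, ℝ^ℓ_*)`. -/
def MemKMInf (d ℓ m : ℕ) (a : ℝ) (u : Ed d → ℝ) : Prop :=
  MemKInf d (ModelDomain d ℓ) (rhoModel d ℓ) m a u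

/-- The norm of the model Kondratiev space `𝒦^m_{a,∞}(ℝ^d, ℝ^ℓ_*)`. -/
def KnormMInf (d ℓ m : ℕ) (a : ℝ) (u : Ed d → ℝ) : ℝ :=
  KnormInf d (ModelDomain d ℓ) (rhoModel d ℓ) m a u

/-! ### Words of partial derivatives -/

/-- Iterated partial derivative along a word of coordinate directions. -/
def wd (d : ℕ) (w : List (Fin d)) (f : Ed d → ℝ) : Ed d → ℝ := w.foldr (pderivI d) f

/-- The canonical word belonging to a multi-index. -/
def wordOf (d : ℕ) (α : Fin d → ℕ) : List (Fin d) :=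
  (List.finRange d).flatMap fun i => List.replicate (α i) i

/-- Smooth functions. -/
abbrev Smooth (d : ℕ) (f : Ed d → ℝ) : Prop := ContDiff ℝ (⊤ : ℕ∞) f

lemma wd_nil (d : ℕ) (f : Ed d → ℝ) : wd d [] f = f := rfl

lemma wd_cons (d : ℕ) (i : Fin d) (w : List (Fin d)) (f : Ed d → ℝ) :
    wd d (i :: w) f = pderivI d i (wd d w f) := rfl

lemma wd_append (d : ℕ) (v w : List (Fin d)) (f : Ed d → ℝ) :
    wd d (v ++ w) f = wd d v (wd d w f) := by
  simp [wd, List.foldr_append]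

lemma wd_replicate (d : ℕ) (i : Fin d) (n : ℕ) (f : Ed d → ℝ) :
    (pderivI d i)^[n] f = wd d (List.replicate n i) f := by
  induction n with
  | zero => rfl
  | succ n ih => rw [Function.iterate_succ_apply', ih, List.replicate_succ, wd_cons]

lemma pderivA_eq_wd (d : ℕ) (α : Fin d → ℕ) (f : Ed d → ℝ) :
    pderivA d α f = wd d (wordOf d α) f := by
  unfold pderivA wordOf
  generalize List.finRange d = l
  induction l with
  | nil => rfl
  | cons i l ih =>
    rw [List.foldr_cons, List.flatMap_cons, wd_append, ← wd_replicate, ← ih]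
    rfl

lemma length_wordOf (d : ℕ) (α : Fin d → ℕ) : (wordOf d α).length = ∑ i, α i := by
  unfold wordOf
  rw [List.length_flatMap]
  simp [← List.ofFn_eq_map, List.sum_ofFn]

lemma count_wordOf (d : ℕ) (α : Fin d → ℕ) (i : Fin d) : (wordOf d α).count i = α i := by
  unfold wordOf
  rw [List.count_flatMap]
  have : (List.map (List.count i ∘ fun i => List.replicate (α i) i) (List.finRange d)).sum
      = ∑ j, if j = i then α j else 0 := by
    rw [← List.ofFn_eq_map, List.sum_ofFn]
    refine Finset.sum_congr rfl fun j _ => ?_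
    simp [List.count_replicate]
  rw [this]; simp

lemma smooth_pderivI {d : ℕ} (i : Fin d) {f : Ed d → ℝ} (hf : Smooth d f) :
    Smooth d (pderivI d i f) := by
  unfold pderivI
  exact (hf.fderiv_right (m := ((⊤ : ℕ∞) : WithTop ℕ∞)) (by simp)).clm_apply contDiff_const

lemma smooth_wd {d : ℕ} (w : List (Fin d)) {f : Ed d → ℝ} (hf : Smooth d f) :
    Smooth d (wd d w f) := by
  induction w with
  | nil => exact hf
  | cons i w ih => exact smooth_pderivI i ih

lemma smooth_pderivA {d : ℕ} (α : Fin d → ℕ) {f : Ed d → ℝ} (hf : Smooth d f) :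
    Smooth d (pderivA d α f) := by
  rw [pderivA_eq_wd]; exact smooth_wd _ hf

lemma pderivI_comm {d : ℕ} (i j : Fin d) {f : Ed d → ℝ} (hf : Smooth d f) :
    pderivI d i (pderivI d j f) = pderivI d j (pderivI d i f) := by
  have hf' : Differentiable ℝ (fderiv ℝ f) :=
    (hf.fderiv_right (m := ((⊤ : ℕ∞) : WithTop ℕ∞)) (by simp)).differentiable (by simp)
  have key : ∀ (i j : Fin d) (x : Ed d), pderivI d i (pderivI d j f) x =
      fderiv ℝ (fderiv ℝ f) x (EuclideanSpace.single i 1) (EuclideanSpace.single j 1) := by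
    intro i j x
    unfold pderivI
    rw [fderiv_clm_apply (hf' x) (by fun_prop)]
    simp
  funext x
  rw [key, key]
  have hs : IsSymmSndFDerivAt ℝ f x := by
    apply ContDiffAt.isSymmSndFDerivAt (n := ((⊤ : ℕ∞) : WithTop ℕ∞)) hf.contDiffAt
    rw [minSmoothness_of_isRCLikeNormedField]
    exact WithTop.coe_le_coe.2 le_top
  exact hs _ _

lemma wd_perm {d : ℕ} {v w : List (Fin d)} (h : v.Perm w) {f : Ed d → ℝ} (hf : Smooth d f) :
    wd d v f = wd d w f := by
  induction h with
  | nil => rfl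
  | cons i _ ih => rw [wd_cons, wd_cons, ih]
  | swap i j l => 
    simp only [wd_cons]
    exact pderivI_comm _ _ (smooth_wd l hf)
  | trans _ _ ih1 ih2 => exact ih1.trans ih2

lemma perm_wordOf {d : ℕ} (w : List (Fin d)) : w.Perm (wordOf d fun i => w.count i) := by
  rw [List.perm_iff_count]
  intro i
  rw [count_wordOf]

lemma sum_count {d : ℕ} (w : List (Fin d)) : ∑ i, w.count i = w.length := by
  rw [← length_wordOf]; exact (perm_wordOf w).length_eq.symm

lemma wd_eq_pderivA {d : ℕ} (w : List (Fin d)) {f : Ed d → ℝ} (hf : Smooth d f) :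
    wd d w f = pderivA d (fun i => w.count i) f := by
  rw [pderivA_eq_wd]; exact wd_perm (perm_wordOf w) hf

lemma wd_pderivA {d : ℕ} (w : List (Fin d)) (β : Fin d → ℕ) {f : Ed d → ℝ} (hf : Smooth d f) :
    wd d w (pderivA d β f) = pderivA d (fun i => β i + w.count i) f := by
  rw [pderivA_eq_wd, ← wd_append, pderivA_eq_wd]
  apply wd_perm _ hf
  rw [List.perm_iff_count]
  intro i
  rw [count_wordOf, List.count_append, count_wordOf, add_comm]

lemma pderivI_scale {d : ℕ} (i : Fin d) (f : Ed d → ℝ) (hf : Differentiable ℝ f) (c : ℝ)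
    (x₀ : Ed d) :
    pderivI d i (fun x => f (c • (x - x₀))) = fun x => c * pderivI d i f (c • (x - x₀)) := by
  funext x
  unfold pderivI
  have h1 : HasFDerivAt (fun x : Ed d => c • (x - x₀)) (c • ContinuousLinearMap.id ℝ (Ed d)) x :=
    ((hasFDerivAt_id x).sub_const x₀).const_smul c
  have h2 := (hf (c • (x - x₀))).hasFDerivAt.comp x h1
  have h3 : fderiv ℝ (fun x => f (c • (x - x₀))) x = _ := h2.fderiv
  rw [h3]
  simp

lemma pderivI_const_mul {d : ℕ} (i : Fin d) (f : Ed d → ℝ) (c : ℝ) (hf : Differentiable ℝ f) :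
    pderivI d i (fun x => c * f x) = fun x => c * pderivI d i f x := by
  funext x
  unfold pderivI
  rw [fderiv_const_mul (hf x)]; simp

lemma Smooth.diff {d : ℕ} {f : Ed d → ℝ} (hf : Smooth d f) : Differentiable ℝ f :=
  hf.differentiable (by simp)

lemma wd_const_mul {d : ℕ} (w : List (Fin d)) {f : Ed d → ℝ} (hf : Smooth d f) (c : ℝ) :
    wd d w (fun x => c * f x) = fun x => c * wd d w f x := by
  induction w with
  | nil => rfl
  | cons i w ih => rw [wd_cons, ih, pderivI_const_mul _ _ _ (smooth_wd w hf).diff]; rfl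

lemma smooth_scale {d : ℕ} {f : Ed d → ℝ} (hf : Smooth d f) (c : ℝ) (x₀ : Ed d) :
    Smooth d (fun x => f (c • (x - x₀))) := by
  unfold Smooth at *
  fun_prop

lemma wd_scale {d : ℕ} (w : List (Fin d)) {f : Ed d → ℝ} (hf : Smooth d f) (c : ℝ) (x₀ : Ed d) :
    wd d w (fun x => f (c • (x - x₀))) = fun x => c ^ w.length * wd d w f (c • (x - x₀)) := by
  induction w with
  | nil => funext x; simp [wd_nil]
  | cons i w ih =>
    rw [wd_cons, ih, pderivI_const_mul _ _ _ (smooth_scale (smooth_wd w hf) c x₀).diff,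
      pderivI_scale _ _ (smooth_wd w hf).diff]
    funext x
    rw [List.length_cons, wd_cons, pow_succ]; ring

lemma pderivA_scale {d : ℕ} (α : Fin d → ℕ) {f : Ed d → ℝ} (hf : Smooth d f) (c : ℝ) (x₀ : Ed d) :
    pderivA d α (fun x => f (c • (x - x₀))) =
      fun x => c ^ (∑ i, α i) * pderivA d α f (c • (x - x₀)) := by
  rw [pderivA_eq_wd, pderivA_eq_wd, wd_scale _ hf, length_wordOf]

lemma pderivA_const_mul {d : ℕ} (α : Fin d → ℕ) {f : Ed d → ℝ} (hf : Smooth d f) (c : ℝ) :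
    pderivA d α (fun x => c * f x) = fun x => c * pderivA d α f x := by
  rw [pderivA_eq_wd, pderivA_eq_wd, wd_const_mul _ hf]

lemma wd_sum {d : ℕ} (w : List (Fin d)) {ι : Type*} (s : Finset ι) (f : ι → Ed d → ℝ)
    (hf : ∀ n, Smooth d (f n)) :
    wd d w (fun x => ∑ n ∈ s, f n x) = fun x => ∑ n ∈ s, wd d w (f n) x := by
  induction w with
  | nil => rfl
  | cons i w ih =>
    rw [wd_cons, ih]
    funext x
    unfold pderivI
    rw [fderiv_fun_sum (fun n _ => (smooth_wd w (hf n)).diff x)]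
    simp [wd_cons, pderivI]

lemma pderivA_sum {d : ℕ} (α : Fin d → ℕ) {ι : Type*} (s : Finset ι) (f : ι → Ed d → ℝ)
    (hf : ∀ n, Smooth d (f n)) :
    pderivA d α (fun x => ∑ n ∈ s, f n x) = fun x => ∑ n ∈ s, pderivA d α (f n) x := by
  simp only [pderivA_eq_wd]
  exact wd_sum _ s f hf

lemma tsupport_wd {d : ℕ} (w : List (Fin d)) (f : Ed d → ℝ) :
    tsupport (wd d w f) ⊆ tsupport f := by
  induction w with
  | nil => exact subset_rfl
  | cons i w ih =>
    rw [wd_cons]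
    refine (closure_minimal ?_ isClosed_closure).trans ih
    intro x hx
    apply support_fderiv_subset ℝ
    intro h
    apply hx
    unfold pderivI
    rw [h]; simp

lemma tsupport_pderivA {d : ℕ} (α : Fin d → ℕ) (f : Ed d → ℝ) :
    tsupport (pderivA d α f) ⊆ tsupport f := by
  rw [pderivA_eq_wd]; exact tsupport_wd _ _

lemma wd_congr_nhds {d : ℕ} (w : List (Fin d)) {f g : Ed d → ℝ} {x : Ed d}
    (h : f =ᶠ[𝓝 x] g) : wd d w f =ᶠ[𝓝 x] wd d w g := by
  induction w with
  | nil => exact h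
  | cons i w ih =>
    filter_upwards [ih.fderiv (𝕜 := ℝ)] with y hy
    simp only [wd_cons, pderivI]
    rw [hy]

lemma mem_multiIdx {d m : ℕ} {α : Fin d → ℕ} : α ∈ multiIdx d m ↔ ∑ i, α i ≤ m := by
  unfold multiIdx
  rw [Finset.mem_filter, Fintype.mem_piFinset]
  constructor
  · exact fun h => h.2
  · intro h
    refine ⟨fun i => ?_, h⟩
    rw [Finset.mem_range]
    have : α i ≤ ∑ i, α i := Finset.single_le_sum (fun _ _ => Nat.zero_le _) (Finset.mem_univ i)
    omega



/-! ### The model domain, uniqueness of weak derivatives -/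

lemma isOpen_model (d ℓ : ℕ) : IsOpen (ModelDomain d ℓ) := by
  unfold ModelDomain
  rw [isOpen_compl_iff]
  have : RStar d ℓ = ⋂ i : Fin d, {x | (i : ℕ) < d - ℓ → x i = 0} := by
    ext x; simp [RStar]
  rw [this]
  refine isClosed_iInter fun i => ?_
  by_cases h : (i : ℕ) < d - ℓ
  · simp only [h, forall_const]
    exact isClosed_eq (by fun_prop) continuous_const
  · simp [h]

lemma volume_RStar (d ℓ : ℕ) (hl : ℓ < d) : volume (RStar d ℓ) = 0 := by
  have hd : 0 < d := by omega
  let i₀ : Fin d := ⟨0, hd⟩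
  let S : Submodule ℝ (Ed d) := 
    LinearMap.ker ((EuclideanSpace.proj (𝕜 := ℝ) i₀ : Ed d →L[ℝ] ℝ) : Ed d →ₗ[ℝ] ℝ)
  have hS : S ≠ ⊤ := by
    intro h
    have : EuclideanSpace.single i₀ (1 : ℝ) ∈ S := by rw [h]; trivial
    have h2 : EuclideanSpace.proj (𝕜 := ℝ) i₀ (EuclideanSpace.single i₀ (1 : ℝ)) = 0 := this
    simp at h2
  refine measure_mono_null ?_ (Measure.addHaar_submodule volume S hS)
  intro x hx
  have : x i₀ = 0 := hx i₀ (by simp only [i₀]; omega)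
  exact this

lemma restrict_model (d ℓ : ℕ) (hl : ℓ < d) :
    (volume : Measure (Ed d)).restrict (ModelDomain d ℓ) = volume := by
  apply Measure.restrict_eq_self_of_ae_mem
  rw [ae_iff]
  convert volume_RStar d ℓ hl using 2
  ext x; simp [ModelDomain]

lemma weak_unique {d ℓ : ℕ} (hl : ℓ < d) {α : Fin d → ℕ} {u v v' : Ed d → ℝ}
    (h : HasWeakDerivOn d (ModelDomain d ℓ) α u v)
    (h' : HasWeakDerivOn d (ModelDomain d ℓ) α u v') : v =ᵐ[volume] v' := by
  have hU := isOpen_model d ℓ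
  have hr := restrict_model d ℓ hl
  have key := hU.ae_eq_zero_of_integral_contDiff_smul_eq_zero (μ := volume)
    (f := fun x => v x - v' x) (h.2.1.sub h'.2.1) (by
      intro g hg hgc hgs
      have e1 := h.2.2 g ⟨hg, hgc, hgs⟩
      have e2 := h'.2.2 g ⟨hg, hgc, hgs⟩
      rw [hr] at e1 e2
      have e3 : ∫ x, v x * g x = ∫ x, v' x * g x := by
        have := e1.symm.trans e2
        exact mul_left_cancel₀ (pow_ne_zero _ (by norm_num)) this
      have hi : ∀ w : Ed d → ℝ, LocallyIntegrableOn w (ModelDomain d ℓ) volume →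
          Integrable (fun x => w x * g x) := by
        intro w hw
        have h1 : IntegrableOn w (tsupport g) := hw.integrableOn_compact_subset hgs hgc.isCompact
        have h2 : IntegrableOn (fun x => w x * g x) (tsupport g) :=
          h1.mul_continuousOn hg.continuous.continuousOn hgc.isCompact
        rw [integrableOn_iff_integrable_of_support_subset] at h2
        · exact h2
        · intro x hx
          apply subset_tsupport g
          intro h0; apply hx; simp [h0]
      have : ∀ x, g x • (v x - v' x) = v x * g x - v' x * g x := by
        intro x; simp only [smul_eq_mul]; ring
      simp_rw [this]
      rw [integral_sub (hi v h.2.1) (hi v' h'.2.1), e3, sub_self])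
  have hae : ∀ᵐ x ∂(volume : Measure (Ed d)), x ∈ ModelDomain d ℓ := by
    rw [← hr]; exact ae_restrict_mem hU.measurableSet
  filter_upwards [key, hae] with x h1 h2
  linarith [h1 h2]

lemma wd_ibp {d : ℕ} (w : List (Fin d)) (u φ : Ed d → ℝ) (hu : Smooth d u)
    (hφ : Smooth d φ) (hc : HasCompactSupport φ) :
    ∫ x, u x * wd d w φ x = (-1 : ℝ) ^ w.length * ∫ x, wd d w.reverse u x * φ x := by
  induction w generalizing u with
  | nil => simp [wd_nil]
  | cons i w ih =>
    have hwc : HasCompactSupport (wd d w φ) := 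
      hc.of_isClosed_subset isClosed_closure (tsupport_wd w φ)
    have hpc : HasCompactSupport (pderivI d i (wd d w φ)) := 
      hc.of_isClosed_subset isClosed_closure (tsupport_wd (i :: w) φ)
    have hloc : ∀ f g : Ed d → ℝ, Smooth d f → Smooth d g → HasCompactSupport g →
        Integrable (fun x => f x * g x) := by
      intro f g hf hg hgc
      exact (hf.continuous.mul hg.continuous).integrable_of_hasCompactSupport hgc.mul_left
    have e := integral_mul_fderiv_eq_neg_fderiv_mul_of_integrable (μ := (volume : Measure (Ed d)))
      (f := u) (g := wd d w φ) (v := EuclideanSpace.single i 1)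
      (hloc (pderivI d i u) _ (smooth_pderivI i hu) (smooth_wd w hφ) hwc)
      (hloc u _ hu (smooth_pderivI i (smooth_wd w hφ)) hpc)
      (hloc u _ hu (smooth_wd w hφ) hwc) (fun x _ => hu.diff x)
      (fun x _ => (smooth_wd w hφ).diff x)
    have e' : ∫ x, u x * wd d (i :: w) φ x = -∫ x, pderivI d i u x * wd d w φ x := e
    rw [e', ih _ (smooth_pderivI i hu), List.length_cons, List.reverse_cons, wd_append, pow_succ]
    simp [wd_cons, wd_nil]

lemma smooth_weak {d ℓ : ℕ} (hl : ℓ < d) (α : Fin d → ℕ) {u : Ed d → ℝ} (hu : Smooth d u) :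
    HasWeakDerivOn d (ModelDomain d ℓ) α u (pderivA d α u) := by
  refine ⟨hu.continuous.locallyIntegrable.locallyIntegrableOn _,
    (smooth_pderivA α hu).continuous.locallyIntegrable.locallyIntegrableOn _, ?_⟩
  intro φ hφ
  rw [restrict_model d ℓ hl, pderivA_eq_wd, wd_ibp _ _ _ hu hφ.1 hφ.2.1, length_wordOf,
    pderivA_eq_wd, wd_perm (List.reverse_perm _) hu]

lemma KnormM_eq {d ℓ m : ℕ} (hl : ℓ < d) {a p : ℝ} {u : Ed d → ℝ} {D : (Fin d → ℕ) → Ed d → ℝ}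
    (h : KMemData d (ModelDomain d ℓ) (rhoModel d ℓ) m a p u D) :
    KnormM d ℓ m a p u = KnormP d (ModelDomain d ℓ) (rhoModel d ℓ) m a p D := by
  have hM : MemK d (ModelDomain d ℓ) (rhoModel d ℓ) m a p u := ⟨D, h⟩
  unfold KnormM Knorm
  rw [dif_pos hM]
  unfold KnormP
  congr 1
  refine Finset.sum_congr rfl fun α hα => ?_
  rw [restrict_model d ℓ hl]
  apply integral_congr_ae
  filter_upwards [weak_unique hl (hM.choose_spec.1 α hα) (h.1 α hα)] with x hx
  unfold kIntegrand
  rw [hx]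

lemma KnormMInf_eq {d ℓ m : ℕ} (hl : ℓ < d) {a : ℝ} {u : Ed d → ℝ}
    {D : (Fin d → ℕ) → Ed d → ℝ} (h : IsWeakDerivFamily d (ModelDomain d ℓ) m u D)
    (hM : MemKMInf d ℓ m a u) :
    KnormMInf d ℓ m a u = KnormInfP d (ModelDomain d ℓ) (rhoModel d ℓ) m a D := by
  unfold KnormMInf KnormInf
  unfold MemKMInf at hM
  rw [dif_pos hM]
  unfold KnormInfP
  refine Finset.sum_congr rfl fun α hα => ?_
  rw [restrict_model d ℓ hl]
  congr 1
  apply eLpNorm_congr_ae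
  filter_upwards [weak_unique hl (hM.choose_spec.1 α hα) (h α hα)] with x hx
  unfold kIntegrandInf
  rw [hx]

lemma KMemDataInf_of {d ℓ m : ℕ} (hl : ℓ < d) {a : ℝ} {u : Ed d → ℝ}
    {D : (Fin d → ℕ) → Ed d → ℝ} (h : IsWeakDerivFamily d (ModelDomain d ℓ) m u D)
    (hM : MemKMInf d ℓ m a u) : KMemDataInf d (ModelDomain d ℓ) (rhoModel d ℓ) m a u D := by
  refine ⟨h, fun α hα => ?_⟩
  obtain ⟨D', h1, h2⟩ := hM
  refine lt_of_eq_of_lt ?_ (h2 α hα)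
  rw [restrict_model d ℓ hl]
  apply eLpNorm_congr_ae
  filter_upwards [weak_unique hl (h1 α hα) (h α hα)] with x hx
  unfold kIntegrandInf
  rw [hx]

/-- The norm `|x'|`. -/
def nrm' (d ℓ : ℕ) (x : Ed d) : ℝ :=
  Real.sqrt (∑ i ∈ Finset.univ.filter (fun i : Fin d => (i : ℕ) < d - ℓ), (x i) ^ 2)

/-- The projection `x ↦ (x', 0)`. -/
def prj (d ℓ : ℕ) (x : Ed d) : Ed d :=
  WithLp.toLp 2 fun i => if (i : ℕ) < d - ℓ then x i else 0

lemma nrm'_eq (d ℓ : ℕ) (x : Ed d) : nrm' d ℓ x = ‖prj d ℓ x‖ := by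
  rw [EuclideanSpace.norm_eq]
  unfold nrm' prj
  congr 1
  rw [Finset.sum_filter]
  refine Finset.sum_congr rfl fun i _ => ?_
  by_cases h : (i : ℕ) < d - ℓ <;> simp [h]

lemma prj_sub (d ℓ : ℕ) (x y : Ed d) : prj d ℓ (x - y) = prj d ℓ x - prj d ℓ y := by
  ext i
  by_cases h : (i : ℕ) < d - ℓ <;> simp [prj, h]

lemma nrm'_le (d ℓ : ℕ) (x : Ed d) : nrm' d ℓ x ≤ ‖x‖ := by
  rw [EuclideanSpace.norm_eq]
  unfold nrm'
  apply Real.sqrt_le_sqrt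
  simp only [Real.norm_eq_abs, sq_abs]
  exact Finset.sum_le_sum_of_subset_of_nonneg (Finset.filter_subset _ _) fun _ _ _ => sq_nonneg _

lemma nrm'_lip (d ℓ : ℕ) (x y : Ed d) : |nrm' d ℓ x - nrm' d ℓ y| ≤ ‖x - y‖ := by
  rw [nrm'_eq, nrm'_eq]
  refine (abs_norm_sub_norm_le _ _).trans ?_
  rw [← prj_sub, ← nrm'_eq]
  exact nrm'_le _ _ _

lemma nrm'_smul (d ℓ : ℕ) (c : ℝ) (hc : 0 ≤ c) (x : Ed d) :
    nrm' d ℓ (c • x) = c * nrm' d ℓ x := by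
  have : prj d ℓ (c • x) = c • prj d ℓ x := by
    ext i
    by_cases h : (i : ℕ) < d - ℓ <;> simp [prj, h]
  rw [nrm'_eq, nrm'_eq, this, norm_smul, Real.norm_of_nonneg hc]

lemma rho_eq (d ℓ : ℕ) (x : Ed d) : rhoModel d ℓ x = min 1 (nrm' d ℓ x) := rfl

lemma nrm'_pos {d ℓ : ℕ} {x : Ed d} : x ∈ ModelDomain d ℓ ↔ 0 < nrm' d ℓ x := by
  have h0 : 0 ≤ nrm' d ℓ x := Real.sqrt_nonneg _
  rw [lt_iff_le_and_ne, and_iff_right h0, nrm'_eq, ne_comm, norm_ne_zero_iff]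
  unfold ModelDomain
  rw [Set.mem_compl_iff, not_iff_not]
  constructor
  · intro h
    ext i
    by_cases hi : (i : ℕ) < d - ℓ
    · simp [prj, hi, h i hi]
    · simp [prj, hi]
  · intro h i hi
    have := congrArg (fun v : Ed d => v i) h
    simpa [prj, hi] using this

lemma rho_pos {d ℓ : ℕ} {x : Ed d} (hx : x ∈ ModelDomain d ℓ) : 0 < rhoModel d ℓ x := by
  rw [rho_eq]; exact lt_min one_pos (nrm'_pos.1 hx)

lemma rho_nonneg (d ℓ : ℕ) (x : Ed d) : 0 ≤ rhoModel d ℓ x := by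
  rw [rho_eq]; exact le_min zero_le_one (Real.sqrt_nonneg _)

lemma rho_le_one (d ℓ : ℕ) (x : Ed d) : rhoModel d ℓ x ≤ 1 := by
  rw [rho_eq]; exact min_le_left _ _

lemma rho_lip (d ℓ : ℕ) (x y : Ed d) : |rhoModel d ℓ x - rhoModel d ℓ y| ≤ ‖x - y‖ := by
  rw [rho_eq, rho_eq]
  refine le_trans ?_ (nrm'_lip d ℓ x y)
  have := abs_min_sub_min_le_max 1 (nrm' d ℓ x) 1 (nrm' d ℓ y)
  simpa using this

lemma mem_model_of_rho {d ℓ : ℕ} {x : Ed d} (hx : 0 < rhoModel d ℓ x) : x ∈ ModelDomain d ℓ := by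
  rw [nrm'_pos]; rw [rho_eq] at hx; exact lt_of_lt_of_le hx (min_le_right _ _)

lemma continuous_nrm' (d ℓ : ℕ) : Continuous (nrm' d ℓ) := by
  unfold nrm'; fun_prop

lemma continuous_rho (d ℓ : ℕ) : Continuous (rhoModel d ℓ) := by
  have : rhoModel d ℓ = fun x => min 1 (nrm' d ℓ x) := rfl
  rw [this]
  exact continuous_const.min (continuous_nrm' d ℓ)



/-! ### Taylor's formula -/

lemma taylor_aux (g : ℕ → ℝ → ℝ) (hg : ∀ j t, HasDerivAt (g j) (g (j + 1) t) t) (k : ℕ) :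
    |g 0 0| ≤ ∑ j ∈ Finset.range (k + 1), |g j 1| + |∫ t in (0 : ℝ)..1, t ^ k * g (k + 1) t| := by
  have hc : ∀ j, Continuous (g j) := fun j =>
    continuous_iff_continuousAt.2 fun t => (hg j t).continuousAt
  induction k with
  | zero =>
    have h1 : ∫ t in (0 : ℝ)..1, g 1 t = g 0 1 - g 0 0 :=
      intervalIntegral.integral_eq_sub_of_hasDerivAt (fun t _ => hg 0 t)
        ((hc 1).intervalIntegrable _ _)
    simp only [pow_zero, one_mul, zero_add, Finset.sum_range_one]
    rw [h1]
    have : g 0 0 = g 0 1 - (g 0 1 - g 0 0) := by ring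
    calc |g 0 0| = |g 0 1 - (g 0 1 - g 0 0)| := by rw [← this]
      _ ≤ _ := abs_sub _ _
  | succ k ih =>
    have h1 : ∫ t in (0 : ℝ)..1, (((k + 1 : ℕ) : ℝ) * t ^ k * g (k + 1) t
        + t ^ (k + 1) * g (k + 2) t) = 1 ^ (k + 1) * g (k + 1) 1 - 0 ^ (k + 1) * g (k + 1) 0 := by
      refine intervalIntegral.integral_eq_sub_of_hasDerivAt (f := fun t => t ^ (k + 1) * g (k + 1) t)
        (fun t _ => ?_) ?_
      · have := (hasDerivAt_pow (k + 1) t).mul (hg (k + 1) t)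
        refine HasDerivAt.congr_deriv (f := fun t => t ^ (k + 1) * g (k + 1) t) this ?_
        simp
      · apply Continuous.intervalIntegrable
        have := hc (k + 1); have := hc (k + 2)
        fun_prop
    have hc1 := hc (k + 1)
    have hc2 := hc (k + 2)
    rw [intervalIntegral.integral_add (Continuous.intervalIntegrable (by fun_prop) _ _)
      (Continuous.intervalIntegrable (by fun_prop) _ _)] at h1
    simp_rw [mul_assoc] at h1
    rw [intervalIntegral.integral_const_mul] at h1
    set A := ∫ t in (0 : ℝ)..1, t ^ k * g (k + 1) t with hA
    set B := ∫ t in (0 : ℝ)..1, t ^ (k + 1) * g (k + 2) t with hB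
    have h2 : ((k + 1 : ℕ) : ℝ) * A = g (k + 1) 1 - B := by
      simp at h1; push_cast; linarith
    have h3 : |A| ≤ |g (k + 1) 1| + |B| := by
      calc |A| ≤ ((k + 1 : ℕ) : ℝ) * |A| := by
            have : (1 : ℝ) ≤ ((k + 1 : ℕ) : ℝ) := by push_cast; linarith [(k.cast_nonneg : (0 : ℝ) ≤ k)]
            nlinarith [abs_nonneg A]
        _ = |((k + 1 : ℕ) : ℝ) * A| := by
            rw [abs_mul, Nat.abs_cast]
        _ ≤ _ := by rw [h2]; exact abs_sub _ _
    rw [Finset.sum_range_succ]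
    linarith

lemma fderiv_eq_sum {d : ℕ} (F : Ed d → ℝ) (z y : Ed d) :
    fderiv ℝ F z y = ∑ i, y i * pderivI d i F z := by
  have : y = ∑ i, y i • EuclideanSpace.single i (1 : ℝ) := by
    ext j
    simp [Pi.single_apply]
  conv_lhs => rw [this]
  simp [pderivI]

lemma taylor_words {d : ℕ} (v : Ed d → ℝ) (hv : Smooth d v) (x y : Ed d) (k : ℕ) :
    ‖v x‖ₑ ≤ ∑ j ∈ Finset.range (k + 1), ∑ w : Fin j → Fin d,
        ENNReal.ofReal (‖y‖ ^ j) * ‖wd d (List.ofFn w) v (x + y)‖ₑ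
      + ∑ w : Fin (k + 1) → Fin d, ∫⁻ t in Ioc (0 : ℝ) 1, ENNReal.ofReal (t ^ k) *
          (ENNReal.ofReal (‖y‖ ^ (k + 1)) * ‖wd d (List.ofFn w) v (x + t • y)‖ₑ) := by
  let g : ℕ → ℝ → ℝ := fun j t => ∑ w : Fin j → Fin d, (∏ i, y (w i)) *
    wd d (List.ofFn w) v (x + t • y)
  have hg : ∀ j t, HasDerivAt (g j) (g (j + 1) t) t := by
    intro j t
    have e : g (j + 1) t = ∑ w : Fin j → Fin d, (∏ i, y (w i)) *
        fderiv ℝ (wd d (List.ofFn w) v) (x + t • y) y := by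
      simp only [g]
      rw [← (Fin.consEquiv (fun _ : Fin (j + 1) => Fin d)).sum_comp, Fintype.sum_prod_type,
        Finset.sum_comm]
      refine Finset.sum_congr rfl fun w _ => ?_
      rw [fderiv_eq_sum, Finset.mul_sum]
      refine Finset.sum_congr rfl fun i _ => ?_
      simp [Fin.consEquiv, Fin.prod_univ_succ, List.ofFn_succ, wd_cons]
      ring
    rw [e]
    apply HasDerivAt.fun_sum
    intro w _
    apply HasDerivAt.const_mul
    have h1 : HasDerivAt (fun t : ℝ => x + t • y) y t := by
      simpa using ((hasDerivAt_id t).smul_const y).const_add x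
    exact ((smooth_wd _ hv).diff (x + t • y)).hasFDerivAt.comp_hasDerivAt t h1
  have hb : ∀ j t, ‖g j t‖ₑ ≤ ∑ w : Fin j → Fin d, ENNReal.ofReal (‖y‖ ^ j) *
      ‖wd d (List.ofFn w) v (x + t • y)‖ₑ := by
    intro j t
    refine (enorm_sum_le _ _).trans (Finset.sum_le_sum fun w _ => ?_)
    rw [enorm_mul]
    gcongr
    rw [Real.enorm_eq_ofReal_abs]
    apply ENNReal.ofReal_le_ofReal
    rw [Finset.abs_prod]
    calc ∏ i, |y (w i)| ≤ ∏ i : Fin j, ‖y‖ := by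
          apply Finset.prod_le_prod (fun _ _ => abs_nonneg _)
          intro i _
          exact PiLp.norm_apply_le y (w i)
      _ = ‖y‖ ^ j := by simp
  have hT := taylor_aux g hg k
  have h0 : g 0 0 = v x := by simp [g, wd_nil]
  have hc : ∀ j, Continuous (g j) := fun j =>
    continuous_iff_continuousAt.2 fun t => (hg j t).continuousAt
  rw [h0] at hT
  have hT' : ‖v x‖ₑ ≤ ∑ j ∈ Finset.range (k + 1), ‖g j 1‖ₑ
      + ‖∫ t in (0 : ℝ)..1, t ^ k * g (k + 1) t‖ₑ := by
    simp only [Real.enorm_eq_ofReal_abs]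
    rw [← ENNReal.ofReal_sum_of_nonneg (fun _ _ => abs_nonneg _), ← ENNReal.ofReal_add
      (Finset.sum_nonneg fun _ _ => abs_nonneg _) (abs_nonneg _)]
    exact ENNReal.ofReal_le_ofReal hT
  refine hT'.trans (add_le_add (Finset.sum_le_sum fun j _ => ?_) ?_)
  · simpa using hb j 1
  · rw [intervalIntegral.integral_of_le zero_le_one]
    refine (enorm_integral_le_lintegral_enorm _).trans ?_
    rw [← lintegral_finsetSum']
    · refine setLIntegral_mono' measurableSet_Ioc fun t ht => ?_
      rw [enorm_mul, ← Finset.mul_sum]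
      refine mul_le_mul' ?_ (hb (k + 1) t)
      rw [Real.enorm_eq_ofReal_abs, abs_of_nonneg (pow_nonneg ht.1.le _)]
    · intro w _
      have := (smooth_wd (List.ofFn w) hv).continuous
      apply Measurable.aemeasurable
      apply Measurable.fun_mul
      · fun_prop
      · apply Measurable.const_mul
        apply Continuous.measurable
        fun_prop

/-- The remainder operator. -/
def TT (d k : ℕ) (r : ℝ) (F : Ed d → ℝ≥0∞) (x : Ed d) : ℝ≥0∞ :=
  ∫⁻ y in ball (0 : Ed d) r, ∫⁻ t in Ioc (0 : ℝ) 1, ENNReal.ofReal (t ^ k) *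
          (ENNReal.ofReal (‖y‖ ^ (k + 1)) * F (x + t • y))

lemma taylor_int {d : ℕ} (v : Ed d → ℝ) (hv : Smooth d v) (x : Ed d) (k : ℕ) (r : ℝ) :
    volume (ball (0 : Ed d) r) * ‖v x‖ₑ ≤ (∑ j ∈ Finset.range (k + 1), ∑ w : Fin j → Fin d,
        ENNReal.ofReal (r ^ j) * ∫⁻ y in ball (0 : Ed d) r, ‖wd d (List.ofFn w) v (x + y)‖ₑ)
      + ∑ w : Fin (k + 1) → Fin d, TT d k r (fun z => ‖wd d (List.ofFn w) v z‖ₑ) x := by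
  calc volume (ball (0 : Ed d) r) * ‖v x‖ₑ = ∫⁻ y in ball (0 : Ed d) r, ‖v x‖ₑ := by
        rw [setLIntegral_const, mul_comm]
    _ ≤ ∫⁻ y in ball (0 : Ed d) r, (∑ j ∈ Finset.range (k + 1), ∑ w : Fin j → Fin d,
        ENNReal.ofReal (r ^ j) * ‖wd d (List.ofFn w) v (x + y)‖ₑ
      + ∑ w : Fin (k + 1) → Fin d, ∫⁻ t in Ioc (0 : ℝ) 1, ENNReal.ofReal (t ^ k) *
          (ENNReal.ofReal (‖y‖ ^ (k + 1)) * ‖wd d (List.ofFn w) v (x + t • y)‖ₑ)) := by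
        refine setLIntegral_mono' measurableSet_ball fun y hy => ?_
        refine (taylor_words v hv x y k).trans ?_
        gcongr
        exact (mem_ball_zero_iff.1 hy).le
    _ = _ := by
        have hm : ∀ {j} (w : Fin j → Fin d), Measurable fun y : Ed d =>
            ‖wd d (List.ofFn w) v (x + y)‖ₑ := by
          intro j w
          have := (smooth_wd (List.ofFn w) hv).continuous
          apply Continuous.measurable
          fun_prop
        rw [lintegral_add_left, lintegral_finsetSum, lintegral_finsetSum]
        · refine congrArg₂ (· + ·) ?_ rfl
          refine Finset.sum_congr rfl fun j _ => ?_
          rw [lintegral_finsetSum]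
          · refine Finset.sum_congr rfl fun w _ => ?_
            rw [lintegral_const_mul _ (hm w)]
          · exact fun w _ => (hm w).const_mul _
        · intro w _
          have := (smooth_wd (List.ofFn w) hv).continuous
          apply Measurable.lintegral_prod_right' (f := fun q : Ed d × ℝ => ENNReal.ofReal (q.2 ^ k) *
            (ENNReal.ofReal (‖q.1‖ ^ (k + 1)) * ‖wd d (List.ofFn w) v (x + q.2 • q.1)‖ₑ))
          apply Measurable.fun_mul (by fun_prop)
          apply Measurable.fun_mul (by fun_prop)
          apply Continuous.measurable
          fun_prop
        · intro j _
          exact Finset.measurable_sum _ fun w _ => (hm w).const_mul _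
        · exact Finset.measurable_sum _ fun j _ =>
            Finset.measurable_sum _ fun w _ => (hm w).const_mul _



/-! ### Bounds for the remainder operator -/

lemma lint_smul {d : ℕ} (F : Ed d → ℝ≥0∞) (hF : Measurable F) {t : ℝ} (ht : 0 < t) :
    ∫⁻ y, F (t • y) = ENNReal.ofReal ((t ^ d)⁻¹) * ∫⁻ y, F y := by
  have h := Measure.map_addHaar_smul (volume : Measure (Ed d)) ht.ne'
  have h2 : ∫⁻ y, F y ∂(Measure.map (fun x => t • x) (volume : Measure (Ed d)))
      = ∫⁻ y, F (t • y) := lintegral_map hF (measurable_const_smul t)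
  rw [← h2, h, lintegral_smul_measure]
  simp [abs_of_pos ht]

lemma holder_set {d : ℕ} (F : Ed d → ℝ≥0∞) (hF : Measurable F) {p : ℝ} (hp : 1 ≤ p)
    (S : Set (Ed d)) :
    ∫⁻ y in S, F y ≤ volume S ^ (1 - 1 / p) * (∫⁻ y in S, F y ^ p) ^ (1 / p) := by
  rcases hp.eq_or_lt with rfl | hp
  · simp
  · have hq : p.HolderConjugate (p.conjExponent) := Real.HolderConjugate.conjExponent hp
    have h := ENNReal.lintegral_mul_le_Lp_mul_Lq (volume.restrict S) hq hF.aemeasurable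
      (aemeasurable_const (b := (1 : ℝ≥0∞)))
    have e : 1 / p.conjExponent = 1 - 1 / p := by
      have := hq.inv_add_inv_eq_one
      rw [one_div, one_div]; linarith
    simp only [Pi.mul_apply, mul_one, ENNReal.one_rpow, lintegral_const, one_mul,
      Measure.restrict_apply_univ, e] at h
    rw [mul_comm]; exact h

/-- Boundedness of the remainder operator. -/
def TBound (d k : ℕ) (p : ℝ) (C : ℝ≥0∞) : Prop :=
  ∀ F : Ed d → ℝ≥0∞, Measurable F → ∀ (x : Ed d) (r : ℝ), 0 < r →
    TT d k r F x ≤ C * (ENNReal.ofReal (r ^ (k + 1)) *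
      (volume (ball (0 : Ed d) r) ^ (1 - 1 / p) * (∫⁻ y, F y ^ p) ^ (1 / p)))

lemma TT_swap {d : ℕ} (k : ℕ) (r : ℝ) (F : Ed d → ℝ≥0∞) (hF : Measurable F) (x : Ed d) :
    TT d k r F x = ∫⁻ t in Ioc (0 : ℝ) 1, ∫⁻ y in ball (0 : Ed d) r, ENNReal.ofReal (t ^ k) *
          (ENNReal.ofReal (‖y‖ ^ (k + 1)) * F (x + t • y)) := by
  unfold TT
  apply lintegral_lintegral_swap
  apply Measurable.aemeasurable
  apply Measurable.fun_mul (by fun_prop)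
  apply Measurable.fun_mul (by fun_prop)
  apply hF.comp
  fun_prop

lemma lint_rpow {s : ℝ} (hs : -1 < s) :
    ∫⁻ t in Ioc (0 : ℝ) 1, ENNReal.ofReal (t ^ s) = ENNReal.ofReal (1 / (s + 1)) := by
  have h1 : IntegrableOn (fun t : ℝ => t ^ s) (Ioc 0 1) := by
    have := intervalIntegral.intervalIntegrable_rpow' (a := 0) (b := 1) hs
    rwa [intervalIntegrable_iff_integrableOn_Ioc_of_le zero_le_one] at this
  rw [← ofReal_integral_eq_lintegral_ofReal h1]
  · rw [← intervalIntegral.integral_of_le zero_le_one, integral_rpow (Or.inl hs)]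
    rw [Real.one_rpow, Real.zero_rpow (by linarith), sub_zero]
  · filter_upwards [ae_restrict_mem measurableSet_Ioc] with t ht
    exact Real.rpow_nonneg ht.1.le _

lemma tbound_A {d k : ℕ} {p : ℝ} (hp : 1 ≤ p) (h : (d : ℝ) / p < k + 1) :
    TBound d k p (ENNReal.ofReal (1 / (k - d / p + 1))) := by
  intro F hF x r hr
  have hp0 : 0 < p := by linarith
  rw [TT_swap k r F hF x]
  set V := volume (ball (0 : Ed d) r) ^ (1 - 1 / p) with hV
  set N := (∫⁻ y, F y ^ p) ^ (1 / p) with hN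
  calc _ ≤ ∫⁻ t in Ioc (0 : ℝ) 1, ENNReal.ofReal (t ^ ((k : ℝ) - d / p)) *
        (ENNReal.ofReal (r ^ (k + 1)) * (V * N)) := by
        refine setLIntegral_mono' measurableSet_Ioc fun t ht => ?_
        have hFt : Measurable fun y => F (x + t • y) := hF.comp (by fun_prop)
        calc _ ≤ ∫⁻ y in ball (0 : Ed d) r, ENNReal.ofReal (t ^ k) *
              (ENNReal.ofReal (r ^ (k + 1)) * F (x + t • y)) := by
              refine setLIntegral_mono' measurableSet_ball fun y hy => ?_
              gcongr
              exact (mem_ball_zero_iff.1 hy).le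
          _ = ENNReal.ofReal (t ^ k) * (ENNReal.ofReal (r ^ (k + 1)) *
              ∫⁻ y in ball (0 : Ed d) r, F (x + t • y)) := by
              rw [lintegral_const_mul _ (hFt.const_mul _), lintegral_const_mul _ hFt]
          _ ≤ ENNReal.ofReal (t ^ k) * (ENNReal.ofReal (r ^ (k + 1)) *
              (V * (ENNReal.ofReal ((t ^ d)⁻¹) ^ (1 / p) * N))) := by
              gcongr
              refine (holder_set _ hFt hp _).trans ?_
              gcongr
              rw [hN, ← ENNReal.mul_rpow_of_nonneg _ _ (by positivity)]
              gcongr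
              refine (setLIntegral_le_lintegral _ _).trans ?_
              have hG : Measurable fun z => F (x + z) ^ p :=
                (hF.comp (measurable_const_add x)).pow_const p
              rw [lint_smul (fun z => F (x + z) ^ p) hG ht.1,
                lintegral_add_left_eq_self (fun z => F z ^ p) x]
          _ = _ := by
              have e : ENNReal.ofReal (t ^ k) * ENNReal.ofReal ((t ^ d)⁻¹) ^ (1 / p)
                  = ENNReal.ofReal (t ^ ((k : ℝ) - d / p)) := by
                have h0 := ht.1
                rw [ENNReal.ofReal_rpow_of_pos (by positivity), ← ENNReal.ofReal_mul (by positivity)]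
                congr 1
                rw [← Real.rpow_natCast t d, ← Real.rpow_neg h0.le, ← Real.rpow_mul h0.le,
                  ← Real.rpow_natCast t k, ← Real.rpow_add h0]
                congr 1
                ring
              rw [← e]
              ring
    _ = _ := by
        rw [lintegral_mul_const _ (by fun_prop), lint_rpow (by linarith)]

/-- Auxiliary set for the borderline case. -/
def SB (d : ℕ) (r : ℝ) : Set (Ed d × ℝ) := {q | ‖q.1‖ < q.2 * r}

/-- Auxiliary kernel for the borderline case. -/
def HB (d k : ℕ) (r : ℝ) (F : Ed d → ℝ≥0∞) (x : Ed d) (z : Ed d) (t : ℝ) : ℝ≥0∞ :=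
  (SB d r).indicator (fun q => ENNReal.ofReal (‖q.1‖ ^ (k + 1)) *
    (F (x + q.1) * ENNReal.ofReal (q.2 ^ (-(d : ℝ) - 1)))) (z, t)

lemma measurable_HB {d k : ℕ} {r : ℝ} {F : Ed d → ℝ≥0∞} (hF : Measurable F) (x : Ed d) :
    Measurable (fun q : Ed d × ℝ => HB d k r F x q.1 q.2) := by
  have hS : MeasurableSet (SB d r) := (isOpen_lt (by fun_prop) (by fun_prop)).measurableSet
  have : (fun q : Ed d × ℝ => HB d k r F x q.1 q.2) = (SB d r).indicator
      (fun q => ENNReal.ofReal (‖q.1‖ ^ (k + 1)) *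
      (F (x + q.1) * ENNReal.ofReal (q.2 ^ (-(d : ℝ) - 1)))) := by
    ext q; rfl
  rw [this]
  refine Measurable.indicator ?_ hS
  apply Measurable.fun_mul (by fun_prop)
  apply Measurable.fun_mul
  · exact hF.comp (by fun_prop)
  · fun_prop

lemma HB_scale {d k : ℕ} {r : ℝ} {F : Ed d → ℝ≥0∞} (x y : Ed d) {t : ℝ}
    (h0 : 0 < t) : (ball (0 : Ed d) r).indicator (fun y => ENNReal.ofReal (t ^ k) *
          (ENNReal.ofReal (‖y‖ ^ (k + 1)) * F (x + t • y))) y =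
      ENNReal.ofReal (t ^ d) * HB d k r F x (t • y) t := by
  unfold HB
  by_cases hy : y ∈ ball (0 : Ed d) r
  · have hy' : (t • y, t) ∈ SB d r := by
      simp only [SB, mem_ofPred_eq, norm_smul, Real.norm_of_nonneg h0.le]
      have := mem_ball_zero_iff.1 hy
      gcongr
    rw [indicator_of_mem hy, indicator_of_mem hy']
    have e : ENNReal.ofReal (t ^ k) * ENNReal.ofReal (‖y‖ ^ (k + 1)) =
      ENNReal.ofReal (t ^ d) * (ENNReal.ofReal (‖t • y‖ ^ (k + 1)) *
        ENNReal.ofReal (t ^ (-(d : ℝ) - 1))) := by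
      rw [← ENNReal.ofReal_mul (by positivity), ← ENNReal.ofReal_mul (by positivity),
        ← ENNReal.ofReal_mul (by positivity)]
      congr 1
      rw [norm_smul, Real.norm_of_nonneg h0.le, Real.rpow_sub h0, Real.rpow_neg h0.le,
        Real.rpow_natCast, Real.rpow_one, mul_pow, pow_succ]
      field_simp
      ring
    rw [← mul_assoc, e]
    simp only [mul_assoc]
    congr 2
    exact mul_comm _ _
  · have hy' : (t • y, t) ∉ SB d r := by
      simp only [SB, mem_ofPred_eq, norm_smul, Real.norm_of_nonneg h0.le, not_lt]
      have : r ≤ ‖y‖ := by simpa using hy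
      gcongr
    rw [indicator_of_notMem hy, indicator_of_notMem hy', mul_zero]

lemma HB_bound {d k : ℕ} (hd : 1 ≤ d) (h : d ≤ k + 1) {r : ℝ} (hr : 0 < r)
    (F : Ed d → ℝ≥0∞) (x z : Ed d) :
    ∫⁻ t in Ioc (0 : ℝ) 1, HB d k r F x z t ≤
      ENNReal.ofReal ((1 / d) * r ^ (k + 1)) * F (x + z) := by
  have hd0 : (0 : ℝ) < d := by exact_mod_cast hd
  by_cases hz0 : ‖z‖ = 0
  · have : ∀ t, HB d k r F x z t = 0 := by
      intro t
      apply indicator_apply_eq_zero.2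
      intro _
      simp [hz0]
    simp [this]
  have hz : 0 < ‖z‖ := lt_of_le_of_ne (norm_nonneg _) (Ne.symm hz0)
  by_cases hzr : r ≤ ‖z‖
  · have : ∫⁻ t in Ioc (0 : ℝ) 1, HB d k r F x z t = 0 := by
      rw [← lintegral_zero (μ := volume.restrict (Ioc (0 : ℝ) 1))]
      refine setLIntegral_congr_fun measurableSet_Ioc fun t ht => ?_
      apply indicator_of_notMem
      simp only [SB, mem_ofPred_eq, not_lt]
      nlinarith [ht.2]
    rw [this]; exact zero_le
  rw [not_le] at hzr
  have hc : 0 < ‖z‖ / r := by positivity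
  have hlt : -(d : ℝ) - 1 < -1 := by linarith
  calc ∫⁻ t in Ioc (0 : ℝ) 1, HB d k r F x z t ≤ ∫⁻ t, (Ioi (‖z‖ / r)).indicator (fun t =>
        (ENNReal.ofReal (‖z‖ ^ (k + 1)) * F (x + z)) * ENNReal.ofReal (t ^ (-(d : ℝ) - 1))) t := by
        refine (setLIntegral_le_lintegral _ _).trans (lintegral_mono fun t => ?_)
        unfold HB
        by_cases ht : (z, t) ∈ SB d r
        · have ht' : t ∈ Ioi (‖z‖ / r) := by
            simp only [SB, mem_ofPred_eq] at ht
            rw [mem_Ioi, div_lt_iff₀ hr]; exact ht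
          rw [indicator_of_mem ht, indicator_of_mem ht', mul_assoc]
        · rw [indicator_of_notMem ht]; exact zero_le
    _ = (ENNReal.ofReal (‖z‖ ^ (k + 1)) * F (x + z)) *
          ENNReal.ofReal ((‖z‖ / r) ^ (-(d : ℝ)) / d) := by
        rw [lintegral_indicator measurableSet_Ioi, lintegral_const_mul _ (by fun_prop),
          ← ofReal_integral_eq_lintegral_ofReal (integrableOn_Ioi_rpow_of_lt hlt hc)]
        · rw [integral_Ioi_rpow_of_lt hlt hc]
          congr 2
          rw [sub_add_cancel, neg_div_neg_eq]
        · filter_upwards [ae_restrict_mem measurableSet_Ioi] with t ht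
          exact Real.rpow_nonneg (hc.trans ht).le _
    _ = (ENNReal.ofReal (‖z‖ ^ (k + 1) * ((‖z‖ / r) ^ (-(d : ℝ)) / d))) * F (x + z) := by
        rw [ENNReal.ofReal_mul (by positivity)]
        simp only [mul_assoc]
        congr 1
        exact mul_comm _ _
    _ ≤ ENNReal.ofReal ((1 / d) * r ^ (k + 1)) * F (x + z) := by
        refine mul_le_mul' (ENNReal.ofReal_le_ofReal ?_) le_rfl
        rw [Real.rpow_neg hc.le, Real.rpow_natCast]
        obtain ⟨e, he⟩ := Nat.exists_eq_add_of_le h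
        rw [he, pow_add, pow_add, div_pow]
        have : ‖z‖ ^ d * ‖z‖ ^ e * ((‖z‖ ^ d / r ^ d)⁻¹ / d) = 1 / d * (r ^ d * ‖z‖ ^ e) := by
          field_simp
        rw [this]
        gcongr

attribute [irreducible] HB

lemma TT_HB {d k : ℕ} {r : ℝ} {F : Ed d → ℝ≥0∞} (hF : Measurable F) (x : Ed d) :
    TT d k r F x = ∫⁻ t in Ioc (0 : ℝ) 1, ∫⁻ z, HB d k r F x z t := by
  rw [TT_swap k r F hF x]
  have hH := measurable_HB (k := k) (r := r) hF x
  have hHt : ∀ t, Measurable fun z => HB d k r F x z t := fun t =>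
    hH.comp (g := fun q : Ed d × ℝ => HB d k r F x q.1 q.2) (f := fun z => (z, t))
      (measurable_id.prodMk measurable_const)
  refine setLIntegral_congr_fun measurableSet_Ioc fun t ht => ?_
  have h0 := ht.1
  have e2 : ∫⁻ y in ball (0 : Ed d) r, ENNReal.ofReal (t ^ k) *
    (ENNReal.ofReal (‖y‖ ^ (k + 1)) * F (x + t • y)) =
      ∫⁻ y, ENNReal.ofReal (t ^ d) * HB d k r F x (t • y) t := by
    rw [← lintegral_indicator measurableSet_ball]
    exact lintegral_congr fun y => HB_scale x y h0
  refine e2.trans ?_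
  rw [lint_smul (fun z => ENNReal.ofReal (t ^ d) * HB d k r F x z t)
    ((hHt t).const_mul _) h0]
  rw [lintegral_const_mul _ (hHt t), ← mul_assoc,
    ← ENNReal.ofReal_mul (by positivity), inv_mul_cancel₀ (by positivity),
    ENNReal.ofReal_one, one_mul]

lemma TT_le_B {d k : ℕ} (hd : 1 ≤ d) (h : d ≤ k + 1) {r : ℝ} (hr : 0 < r) {F : Ed d → ℝ≥0∞}
    (hF : Measurable F) (x : Ed d) :
    TT d k r F x ≤ ENNReal.ofReal ((1 / d) * r ^ (k + 1)) * ∫⁻ z, F z := by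
  have hH := measurable_HB (k := k) (r := r) hF x
  have hFx : Measurable fun z => F (x + z) := hF.comp (measurable_const_add x)
  have h1 : ∫⁻ t in Ioc (0 : ℝ) 1, ∫⁻ z, HB d k r F x z t
      = ∫⁻ z, ∫⁻ t in Ioc (0 : ℝ) 1, HB d k r F x z t := by
    apply lintegral_lintegral_swap
    apply Measurable.aemeasurable
    exact hH.comp (g := fun q : Ed d × ℝ => HB d k r F x q.1 q.2) (f := fun z : ℝ × Ed d => (z.2, z.1))
      measurable_swap
  have h2 : ∫⁻ z, ∫⁻ t in Ioc (0 : ℝ) 1, HB d k r F x z t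
      ≤ ∫⁻ z, ENNReal.ofReal ((1 / d) * r ^ (k + 1)) * F (x + z) :=
    lintegral_mono fun z => HB_bound hd h hr F x z
  rw [TT_HB hF, h1]
  refine h2.trans (le_of_eq ?_)
  rw [lintegral_const_mul _ hFx, lintegral_add_left_eq_self F x]

lemma tbound_B {d k : ℕ} (hd : 1 ≤ d) (h : d ≤ k + 1) :
    TBound d k 1 (ENNReal.ofReal (1 / d)) := by
  intro F hF x r hr
  refine (TT_le_B hd h hr hF x).trans (le_of_eq ?_)
  have e1 : ∀ y, F y ^ (1 : ℝ) = F y := fun y => ENNReal.rpow_one _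
  simp_rw [e1]
  rw [div_one, sub_self, ENNReal.rpow_zero, ENNReal.rpow_one, one_mul,
    ENNReal.ofReal_mul (by positivity), mul_assoc]



/-! ### Mollification -/

/-- Mollification of `u` with kernel `ψ`. -/
def mol (d : ℕ) (u ψ : Ed d → ℝ) : Ed d → ℝ :=
  convolution u ψ (ContinuousLinearMap.lsmul ℝ ℝ) volume

lemma mol_apply {d : ℕ} (u ψ : Ed d → ℝ) (x : Ed d) : mol d u ψ x = ∫ z, u z * ψ (x - z) := rfl

lemma smooth_mol {d : ℕ} {u ψ : Ed d → ℝ} (hu : LocallyIntegrable u) (hψ : Smooth d ψ)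
    (hc : HasCompactSupport ψ) : Smooth d (mol d u ψ) :=
  hc.contDiff_convolution_right _ hu hψ

lemma pderivI_mol {d : ℕ} {u ψ : Ed d → ℝ} (hu : LocallyIntegrable u) (hψ : Smooth d ψ)
    (hc : HasCompactSupport ψ) (i : Fin d) :
    pderivI d i (mol d u ψ) = mol d u (pderivI d i ψ) := by
  funext x
  have h1 : ContDiff ℝ 1 ψ := hψ.of_le (by exact_mod_cast le_top)
  have h := hc.hasFDerivAt_convolution_right (ContinuousLinearMap.lsmul ℝ ℝ) hu h1 x
  have h2 : fderiv ℝ (mol d u ψ) x = _ := h.fderiv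
  unfold pderivI
  rw [h2, convolution_precompR_apply _ hu (hc.fderiv (𝕜 := ℝ)) (h1.continuous_fderiv (by simp))]
  rfl

lemma wd_mol {d : ℕ} {u ψ : Ed d → ℝ} (hu : LocallyIntegrable u) (hψ : Smooth d ψ)
    (hc : HasCompactSupport ψ) (w : List (Fin d)) :
    wd d w (mol d u ψ) = mol d u (wd d w ψ) := by
  induction w with
  | nil => rfl
  | cons i w ih =>
    rw [wd_cons, ih, pderivI_mol hu (smooth_wd w hψ)
      (hc.of_isClosed_subset isClosed_closure (tsupport_wd w ψ)), wd_cons]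

lemma weak_mol {d ℓ : ℕ} (hl : ℓ < d) {α : Fin d → ℕ} {u v : Ed d → ℝ}
    (h : HasWeakDerivOn d (ModelDomain d ℓ) α u v) {K : Set (Ed d)}
    (hK : K ⊆ ModelDomain d ℓ) (hu : LocallyIntegrable (K.indicator u)) {ψ : Ed d → ℝ}
    (hψ : Smooth d ψ) (hc : HasCompactSupport ψ) {ε : ℝ} (hs : tsupport ψ ⊆ closedBall 0 ε)
    {y : Ed d} (hy : closedBall y ε ⊆ K) :
    pderivA d α (mol d (K.indicator u) ψ) y = mol d (K.indicator v) ψ y := by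
  have hzero : ∀ f : Ed d → ℝ, tsupport f ⊆ closedBall 0 ε → ∀ z, z ∉ K → f (y - z) = 0 := by
    intro f hf z hz
    by_contra h0
    apply hz
    apply hy
    have := hf (subset_tsupport f h0)
    rw [mem_closedBall_zero_iff] at this
    rwa [mem_closedBall, dist_comm, dist_eq_norm]
  have hind : ∀ f g : Ed d → ℝ, tsupport f ⊆ closedBall 0 ε →
      ∀ z, K.indicator g z * f (y - z) = g z * f (y - z) := by
    intro f g hf z
    by_cases hz : z ∈ K
    · rw [indicator_of_mem hz]
    · rw [hzero f hf z hz]; simp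
  rw [pderivA_eq_wd, wd_mol hu hψ hc, mol_apply, mol_apply, ← pderivA_eq_wd]
  simp_rw [hind _ u ((tsupport_pderivA α ψ).trans hs), hind _ v hs]
  have hsc : (fun z => ψ (y - z)) = fun z => ψ ((-1 : ℝ) • (z - y)) := by
    funext z; simp
  have htest : IsTestFun d (ModelDomain d ℓ) (fun z => ψ (y - z)) := by
    have hsub : tsupport (fun z => ψ (y - z)) ⊆ closedBall y ε := by
      apply closure_minimal _ isClosed_closedBall
      intro z hz
      have := hs (subset_tsupport ψ hz)
      rw [mem_closedBall_zero_iff] at this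
      rwa [mem_closedBall, dist_comm, dist_eq_norm]
    refine ⟨?_, ?_, hsub.trans (hy.trans hK)⟩
    · rw [hsc]; exact smooth_scale hψ _ _
    · exact (isCompact_closedBall y ε).of_isClosed_subset isClosed_closure hsub
  have e := h.2.2 _ htest
  rw [restrict_model d ℓ hl, hsc, pderivA_scale α hψ] at e
  have e1 : ∀ z : Ed d, (-1 : ℝ) • (z - y) = y - z := by intro z; simp
  simp_rw [e1] at e
  have e2 : ∀ z, u z * ((-1) ^ (∑ i, α i) * pderivA d α ψ (y - z)) =
      (-1) ^ (∑ i, α i) * (u z * pderivA d α ψ (y - z)) := by intro z; ring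
  simp_rw [e2] at e
  rw [integral_const_mul] at e
  exact mul_left_cancel₀ (pow_ne_zero _ (by norm_num)) e

/-- Mollification of nonnegative functions. -/
def mmol (d : ℕ) (F : Ed d → ℝ≥0∞) (ψ : Ed d → ℝ) (x : Ed d) : ℝ≥0∞ :=
  ∫⁻ z, ENNReal.ofReal (ψ z) * F (x - z)

lemma enorm_mol_le {d : ℕ} {v ψ : Ed d → ℝ} {F : Ed d → ℝ≥0∞} (hψ0 : ∀ z, 0 ≤ ψ z)
    (hF : (fun z => ‖v z‖ₑ) =ᵐ[volume] F) (x : Ed d) : ‖mol d v ψ x‖ₑ ≤ mmol d F ψ x := by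
  rw [mol_apply]
  refine (enorm_integral_le_lintegral_enorm _).trans (le_of_eq ?_)
  calc ∫⁻ z, ‖v z * ψ (x - z)‖ₑ = ∫⁻ z, F z * ENNReal.ofReal (ψ (x - z)) := by
        apply lintegral_congr_ae
        filter_upwards [hF] with z hz
        rw [enorm_mul, hz, Real.enorm_eq_ofReal (hψ0 _)]
    _ = ∫⁻ z, F (x - z) * ENNReal.ofReal (ψ z) := by
        rw [← lintegral_sub_left_eq_self (fun z => F z * ENNReal.ofReal (ψ (x - z))) x]
        simp
    _ = _ := by
        unfold mmol
        simp_rw [mul_comm]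

lemma mmol_avg {d : ℕ} {F : Ed d → ℝ≥0∞} (hF : Measurable F) {ψ : Ed d → ℝ}
    (hψ : Measurable ψ) (hψ1 : ∫⁻ z, ENNReal.ofReal (ψ z) = 1)
    {Q : Type*} [MeasurableSpace Q] (ν : Measure Q) [SFinite ν] {c : Q → ℝ≥0∞} (hc : Measurable c)
    {g : Q → Ed d} (hg : Measurable g) (x : Ed d) (M : ℝ≥0∞)
    (hM : ∀ x, ∫⁻ q, c q * F (x + g q) ∂ν ≤ M) :
    ∫⁻ q, c q * mmol d F ψ (x + g q) ∂ν ≤ M := by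
  have hm1 : Measurable fun r : Q × Ed d => F (x + g r.1 - r.2) := hF.comp (by fun_prop)
  have hm2 : Measurable fun r : Q × Ed d => ENNReal.ofReal (ψ r.2) := by fun_prop
  have hm3 : Measurable fun r : Q × Ed d => c r.1 := by fun_prop
  calc ∫⁻ q, c q * mmol d F ψ (x + g q) ∂ν
      = ∫⁻ q, (∫⁻ z : Ed d, c q * (ENNReal.ofReal (ψ z) * F (x + g q - z))) ∂ν := by
        refine lintegral_congr fun q => ?_
        unfold mmol
        rw [lintegral_const_mul]
        exact (hm2.mul hm1).comp (measurable_const.prodMk measurable_id : Measurable fun z => (q, z))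
    _ = ∫⁻ z : Ed d, (∫⁻ q, c q * (ENNReal.ofReal (ψ z) * F (x + g q - z)) ∂ν) := by
        apply lintegral_lintegral_swap
        exact (hm3.mul (hm2.mul hm1)).aemeasurable
    _ ≤ ∫⁻ z : Ed d, ENNReal.ofReal (ψ z) * M := by
        refine lintegral_mono fun z => ?_
        calc ∫⁻ q, c q * (ENNReal.ofReal (ψ z) * F (x + g q - z)) ∂ν
            = ∫⁻ q, ENNReal.ofReal (ψ z) * (c q * F ((x - z) + g q)) ∂ν := by
              refine lintegral_congr fun q => ?_
              rw [show x + g q - z = (x - z) + g q by abel, mul_left_comm]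
          _ = ENNReal.ofReal (ψ z) * ∫⁻ q, c q * F ((x - z) + g q) ∂ν := by
              rw [lintegral_const_mul]
              exact hc.mul (hF.comp (by fun_prop))
          _ ≤ _ := by gcongr; exact hM _
    _ = M := by
        rw [lintegral_mul_const _ (by fun_prop), hψ1, one_mul]

lemma mmol_measurable {d : ℕ} {F : Ed d → ℝ≥0∞} (hF : Measurable F) {ψ : Ed d → ℝ}
    (hψ : Measurable ψ) : Measurable (mmol d F ψ) := by
  unfold mmol
  apply Measurable.lintegral_prod_right' (f := fun q : Ed d × Ed d =>
    ENNReal.ofReal (ψ q.2) * F (q.1 - q.2))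
  exact Measurable.fun_mul (by fun_prop) (hF.comp (by fun_prop))

lemma TT_prod {d : ℕ} (k : ℕ) (r : ℝ) (F : Ed d → ℝ≥0∞) (hF : Measurable F) (x : Ed d) :
    TT d k r F x = ∫⁻ q : Ed d × ℝ, (ENNReal.ofReal (q.2 ^ k) * ENNReal.ofReal (‖q.1‖ ^ (k + 1))) *
      F (x + q.2 • q.1) ∂((volume.restrict (ball (0 : Ed d) r)).prod
        (volume.restrict (Ioc (0 : ℝ) 1))) := by
  rw [lintegral_prod]
  · unfold TT
    simp_rw [mul_assoc]
  · apply Measurable.aemeasurable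
    exact Measurable.fun_mul (by fun_prop) (hF.comp (by fun_prop))

lemma TT_mmol {d : ℕ} (k : ℕ) (r : ℝ) {F : Ed d → ℝ≥0∞} (hF : Measurable F) {ψ : Ed d → ℝ}
    (hψ : Measurable ψ) (hψ1 : ∫⁻ z, ENNReal.ofReal (ψ z) = 1) (x : Ed d) (M : ℝ≥0∞)
    (hM : ∀ x, TT d k r F x ≤ M) : TT d k r (mmol d F ψ) x ≤ M := by
  rw [TT_prod k r _ (mmol_measurable hF hψ)]
  apply mmol_avg hF hψ hψ1 _ (by fun_prop) (g := fun q : Ed d × ℝ => q.2 • q.1) (by fun_prop)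
  intro x
  rw [← TT_prod k r _ hF]
  exact hM x



/-! ### Local estimate -/

/-- The right-hand side of the local estimate. -/
def LB (d k : ℕ) (p r : ℝ) (β : Fin d → ℕ) (N : (Fin d → ℕ) → ℝ≥0∞) : ℝ≥0∞ :=
  ∑ j ∈ Finset.range (k + 2), ∑ w : Fin j → Fin d, ENNReal.ofReal (r ^ j) *
    (volume (ball (0 : Ed d) r) ^ (1 - 1 / p) * N (fun i => β i + (List.ofFn w).count i))

lemma mem_multiIdx_add {d m k : ℕ} {β : Fin d → ℕ} (hβ : ∑ i, β i + (k + 1) ≤ m) {j : ℕ}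
    (hj : j ≤ k + 1) (w : Fin j → Fin d) :
    (fun i => β i + (List.ofFn w).count i) ∈ multiIdx d m := by
  rw [mem_multiIdx, Finset.sum_add_distrib, sum_count, List.length_ofFn]
  omega

lemma mol_bound {d ℓ m : ℕ} (hl : ℓ < d) {u : Ed d → ℝ} {D : (Fin d → ℕ) → Ed d → ℝ}
    (hD : IsWeakDerivFamily d (ModelDomain d ℓ) m u D) {K : Set (Ed d)}
    (hK : K ⊆ ModelDomain d ℓ) (hloc : LocallyIntegrable (K.indicator u))
    {F : (Fin d → ℕ) → Ed d → ℝ≥0∞} (hFm : ∀ α, Measurable (F α))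
    (hF : ∀ α ∈ multiIdx d m, (fun z => ‖K.indicator (D α) z‖ₑ) =ᵐ[volume] F α)
    {ψ : Ed d → ℝ} (hψ : Smooth d ψ) (hc : HasCompactSupport ψ) (hψ0 : ∀ z, 0 ≤ ψ z)
    (hψ1 : ∫⁻ z, ENNReal.ofReal (ψ z) = 1) {ε : ℝ} (hε : 0 ≤ ε)
    (hs : tsupport ψ ⊆ closedBall 0 ε)
    {x : Ed d} {r : ℝ} (hr : 0 < r) (hball : closedBall x (r + ε) ⊆ K) {β : Fin d → ℕ} {k : ℕ}
    (hβ : ∑ i, β i + (k + 1) ≤ m) {p : ℝ} (hp : 1 ≤ p) {C : ℝ≥0∞} (hT : TBound d k p C) :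
    volume (ball (0 : Ed d) r) * ‖mol d (K.indicator (D β)) ψ x‖ₑ ≤
      (1 + C) * LB d k p r β (fun α => (∫⁻ y, F α y ^ p) ^ (1 / p)) := by
  set U := mol d (K.indicator u) ψ with hU
  have hUs : Smooth d U := smooth_mol hloc hψ hc
  have hψm : Measurable ψ := hψ.continuous.measurable
  have hsub : ∀ y ∈ closedBall x r, closedBall y ε ⊆ K := by
    intro y hy z hz
    apply hball
    rw [mem_closedBall] at *
    linarith [dist_triangle z y x]
  have key : ∀ j ≤ k + 1, ∀ w : Fin j → Fin d, ∀ y ∈ closedBall x r,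
      ‖wd d (List.ofFn w) (pderivA d β U) y‖ₑ ≤
        mmol d (F fun i => β i + (List.ofFn w).count i) ψ y := by
    intro j hj w y hy
    have hmem := mem_multiIdx_add hβ hj w
    rw [wd_pderivA _ _ hUs, hU, weak_mol hl (hD _ hmem) hK hloc hψ hc hs (hsub y hy)]
    exact enorm_mol_le hψ0 (hF _ hmem) y
  have hx : pderivA d β U x = mol d (K.indicator (D β)) ψ x :=
    weak_mol hl (hD β (by rw [mem_multiIdx]; omega)) hK hloc hψ hc hs
      (hsub x (mem_closedBall_self hr.le))
  have hmain := taylor_int (pderivA d β U) (smooth_pderivA β hUs) x k r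
  rw [hx] at hmain
  refine hmain.trans ?_
  have t1 : ∀ j ∈ Finset.range (k + 1), ∀ w ∈ (Finset.univ : Finset (Fin j → Fin d)),
      ENNReal.ofReal (r ^ j) * ∫⁻ y in ball (0 : Ed d) r,
        ‖wd d (List.ofFn w) (pderivA d β U) (x + y)‖ₑ ≤
      ENNReal.ofReal (r ^ j) * (volume (ball (0 : Ed d) r) ^ (1 - 1 / p) *
        (∫⁻ y, F (fun i => β i + (List.ofFn w).count i) y ^ p) ^ (1 / p)) := by
    intro j hj w _
    rw [Finset.mem_range] at hj
    gcongr
    calc ∫⁻ y in ball (0 : Ed d) r, ‖wd d (List.ofFn w) (pderivA d β U) (x + y)‖ₑ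
        ≤ ∫⁻ y in ball (0 : Ed d) r,
          1 * mmol d (F fun i => β i + (List.ofFn w).count i) ψ (x + y) := by
          apply setLIntegral_mono' measurableSet_ball
          intro y hy
          rw [one_mul]
          apply key j (by omega) w
          rw [mem_ball_zero_iff] at hy
          simp [hy.le]
      _ ≤ _ := by
          apply mmol_avg (hFm _) hψm hψ1 _ measurable_const (g := fun y => y) measurable_id
          intro z
          simp only [one_mul]
          refine (holder_set (fun y => F (fun i => β i + (List.ofFn w).count i) (z + y))
            ((hFm _).comp (measurable_const_add z)) hp _).trans ?_
          refine mul_le_mul' le_rfl (ENNReal.rpow_le_rpow ?_ (by positivity))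
          refine (setLIntegral_le_lintegral _ _).trans (le_of_eq ?_)
          exact lintegral_add_left_eq_self
            (fun y => F (fun i => β i + (List.ofFn w).count i) y ^ p) z
  have t2 : ∀ w ∈ (Finset.univ : Finset (Fin (k + 1) → Fin d)),
      TT d k r (fun z => ‖wd d (List.ofFn w) (pderivA d β U) z‖ₑ) x ≤
      C * (ENNReal.ofReal (r ^ (k + 1)) * (volume (ball (0 : Ed d) r) ^ (1 - 1 / p) *
        (∫⁻ y, F (fun i => β i + (List.ofFn w).count i) y ^ p) ^ (1 / p))) := by
    intro w _
    calc TT d k r (fun z => ‖wd d (List.ofFn w) (pderivA d β U) z‖ₑ) x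
        ≤ TT d k r (mmol d (F fun i => β i + (List.ofFn w).count i) ψ) x := by
          unfold TT
          apply setLIntegral_mono' measurableSet_ball
          intro y hy
          apply setLIntegral_mono' measurableSet_Ioc
          intro t ht
          gcongr
          apply key _ le_rfl w
          rw [mem_ball_zero_iff] at hy
          simp only [mem_closedBall, dist_self_add_left, norm_smul, Real.norm_eq_abs,
            abs_of_pos ht.1]
          nlinarith [ht.2, ht.1, norm_nonneg y]
      _ ≤ _ := TT_mmol k r (hFm _) hψm hψ1 x _ (fun z => hT _ (hFm _) z r hr)
  refine (add_le_add (Finset.sum_le_sum fun j hj => Finset.sum_le_sum (t1 j hj))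
    (Finset.sum_le_sum t2)).trans ?_
  rw [← Finset.mul_sum]
  unfold LB
  rw [Finset.sum_range_succ _ (k + 1), mul_add, add_mul, add_mul, one_mul, one_mul]
  exact add_le_add le_self_add le_add_self

lemma exists_bumps (d : ℕ) {r : ℝ} (hr : 0 < r) : ∃ φ : ℕ → ContDiffBump (0 : Ed d),
    Tendsto (fun n => (φ n).rOut) atTop (𝓝 0) ∧ (∀ n, (φ n).rOut ≤ 2 * (φ n).rIn) ∧
    ∀ n, (φ n).rOut ≤ r := by
  refine ⟨fun n => ⟨r / (2 * (n + 1)), r / (n + 1), by positivity, ?_⟩, ?_, ?_, ?_⟩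
  · apply div_lt_div_of_pos_left hr (by positivity)
    have : (0 : ℝ) ≤ n := n.cast_nonneg
    linarith
  · have := (tendsto_one_div_add_atTop_nhds_zero_nat (𝕜 := ℝ)).const_mul r
    simp only [mul_zero] at this
    refine this.congr fun n => ?_
    simp [div_eq_mul_inv]
  · intro n
    apply le_of_eq
    show r / (n + 1) = 2 * (r / (2 * (n + 1)))
    field_simp
  · intro n
    apply div_le_self hr.le
    have : (0 : ℝ) ≤ n := n.cast_nonneg
    linarith

lemma local_est {d ℓ m : ℕ} (hl : ℓ < d) {u : Ed d → ℝ} {D : (Fin d → ℕ) → Ed d → ℝ}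
    (hD : IsWeakDerivFamily d (ModelDomain d ℓ) m u D) {x₀ : Ed d} {r : ℝ} (hr : 0 < r)
    (hK : closedBall x₀ (3 * r) ⊆ ModelDomain d ℓ) {β : Fin d → ℕ} {k : ℕ}
    (hβ : ∑ i, β i + (k + 1) ≤ m) {p : ℝ} (hp : 1 ≤ p) {C : ℝ≥0∞} (hT : TBound d k p C) :
    ∀ᵐ x, x ∈ ball x₀ r → volume (ball (0 : Ed d) r) * ‖D β x‖ₑ ≤
      (1 + C) * LB d k p r β
        (fun α => (∫⁻ y in closedBall x₀ (3 * r), ‖D α y‖ₑ ^ p) ^ (1 / p)) := by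
  set K := closedBall x₀ (3 * r) with hKdef
  have hp0 : 0 < p := by linarith
  have hKm : MeasurableSet K := measurableSet_closedBall
  have hI : ∀ f : Ed d → ℝ, LocallyIntegrableOn f (ModelDomain d ℓ) volume → Integrable (K.indicator f) := by
    intro f hf
    rw [integrable_indicator_iff hKm]
    exact hf.integrableOn_compact_subset hK (isCompact_closedBall _ _)
  have hu : LocallyIntegrable (K.indicator u) :=
    (hI u (hD β (by rw [mem_multiIdx]; omega)).1).locallyIntegrable
  have hDi : ∀ α ∈ multiIdx d m, Integrable (K.indicator (D α)) := fun α hα => hI _ (hD α hα).2.1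
  have hF : ∃ F : (Fin d → ℕ) → Ed d → ℝ≥0∞, (∀ α, Measurable (F α)) ∧
      ∀ α ∈ multiIdx d m, (fun z => ‖K.indicator (D α) z‖ₑ) =ᵐ[volume] F α := by
    classical
    have : ∀ α, ∃ G : Ed d → ℝ≥0∞, Measurable G ∧
        (α ∈ multiIdx d m → (fun z => ‖K.indicator (D α) z‖ₑ) =ᵐ[volume] G) := by
      intro α
      by_cases hα : α ∈ multiIdx d m
      · obtain ⟨G, hG, hG'⟩ := (hDi α hα).aestronglyMeasurable.enorm
        exact ⟨G, hG, fun _ => hG'⟩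
      · exact ⟨0, measurable_zero, fun h => absurd h hα⟩
    choose F h1 h2 using this
    exact ⟨F, h1, h2⟩
  obtain ⟨F, hFm, hF⟩ := hF
  have hFeq : ∀ α ∈ multiIdx d m, ∫⁻ y, F α y ^ p = ∫⁻ y in K, ‖D α y‖ₑ ^ p := by
    intro α hα
    rw [← lintegral_indicator hKm]
    apply lintegral_congr_ae
    filter_upwards [hF α hα] with z hz
    rw [← hz]
    by_cases h : z ∈ K
    · simp [h]
    · simp [h, hp0]
  have hLB : LB d k p r β (fun α => (∫⁻ y, F α y ^ p) ^ (1 / p)) =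
      LB d k p r β (fun α => (∫⁻ y in K, ‖D α y‖ₑ ^ p) ^ (1 / p)) := by
    unfold LB
    refine Finset.sum_congr rfl fun j hj => Finset.sum_congr rfl fun w _ => ?_
    rw [Finset.mem_range] at hj
    simp only
    rw [hFeq _ (mem_multiIdx_add hβ (by omega) w)]
  obtain ⟨φ, hφ0, hφK, hφr⟩ := exists_bumps d hr
  have hlim := ContDiffBump.ae_convolution_tendsto_right_of_locallyIntegrable (μ := volume)
    hφ0 (Eventually.of_forall hφK)
    (hDi β (by rw [mem_multiIdx]; omega)).locallyIntegrable
  filter_upwards [hlim] with x hx hxb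
  have hxK : x ∈ K := by
    rw [mem_ball] at hxb
    rw [hKdef, mem_closedBall]; linarith
  rw [indicator_of_mem hxK] at hx
  have hx' : Tendsto (fun n => mol d (K.indicator (D β)) ((φ n).normed volume) x) atTop
      (𝓝 (D β x)) := by
    refine hx.congr fun n => ?_
    rw [convolution_eq_swap, mol_apply]
    simp [mul_comm]
  have hx2 := ENNReal.Tendsto.const_mul (a := volume (ball (0 : Ed d) r)) hx'.enorm
    (Or.inr measure_ball_lt_top.ne)
  rw [← hLB]
  refine le_of_tendsto hx2 (Eventually.of_forall fun n => ?_)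
  refine mol_bound hl hD hK hu hFm hF (ψ := (φ n).normed volume) (φ n).contDiff_normed
    (φ n).hasCompactSupport_normed (fun z => (φ n).nonneg_normed z) ?_ hr.le ?_ hr ?_ hβ hp hT
  · rw [← ofReal_integral_eq_lintegral_ofReal (φ n).integrable_normed
      (Eventually.of_forall fun z => (φ n).nonneg_normed z), (φ n).integral_normed]
    simp
  · rw [(φ n).tsupport_normed_eq]
    exact closedBall_subset_closedBall (hφr n)
  · intro z hz
    rw [mem_closedBall] at hz
    rw [mem_ball] at hxb
    rw [hKdef, mem_closedBall]
    linarith [dist_triangle z x x₀]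


/-! ### Sufficiency -/

lemma pow_comp {x y s A : ℝ} (hx : 0 < x) (hy : 0 < y) (h1 : x ≤ 2 * y) (h2 : y ≤ 2 * x)
    (hs : |s| ≤ A) : x ^ s ≤ 2 ^ A * y ^ s := by
  have h3 : (2 : ℝ) ^ |s| ≤ 2 ^ A := Real.rpow_le_rpow_of_exponent_le (by norm_num) hs
  have h4 : 0 < y ^ s := Real.rpow_pos_of_pos hy s
  refine le_trans ?_ (mul_le_mul_of_nonneg_right h3 h4.le)
  rcases le_total 0 s with h | h
  · rw [abs_of_nonneg h, ← Real.mul_rpow (by norm_num) hy.le]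
    exact Real.rpow_le_rpow hx.le h1 h
  · rw [abs_of_nonpos h, Real.rpow_neg (by norm_num), ← Real.inv_rpow (by norm_num),
      ← Real.mul_rpow (by norm_num) hy.le]
    exact Real.rpow_le_rpow_of_nonpos (by positivity) (by linarith) h

lemma KnormP_nonneg {d ℓ m : ℕ} {a p : ℝ} {D : (Fin d → ℕ) → Ed d → ℝ} :
    0 ≤ KnormP d (ModelDomain d ℓ) (rhoModel d ℓ) m a p D := by
  unfold KnormP
  apply Real.rpow_nonneg
  refine Finset.sum_nonneg fun α _ => integral_nonneg fun x => ?_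
  exact Real.rpow_nonneg (mul_nonneg (Real.rpow_nonneg (rho_nonneg _ _ _) _) (abs_nonneg _)) _

lemma lint_le_KnormP {d ℓ m : ℕ} {a p : ℝ} (hp : 0 < p) {u : Ed d → ℝ}
    {D : (Fin d → ℕ) → Ed d → ℝ}
    (h : KMemData d (ModelDomain d ℓ) (rhoModel d ℓ) m a p u D) {α : Fin d → ℕ}
    (hα : α ∈ multiIdx d m) :
    ∫⁻ x in ModelDomain d ℓ, ENNReal.ofReal (kIntegrand d (rhoModel d ℓ) a p α (D α) x) ≤
      ENNReal.ofReal (KnormP d (ModelDomain d ℓ) (rhoModel d ℓ) m a p D) ^ p := by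
  have h0 : ∀ γ x, 0 ≤ kIntegrand d (rhoModel d ℓ) a p γ (D γ) x := fun γ x =>
    Real.rpow_nonneg (mul_nonneg (Real.rpow_nonneg (rho_nonneg _ _ _) _) (abs_nonneg _)) _
  rw [← ofReal_integral_eq_lintegral_ofReal (h.2 α hα) (Eventually.of_forall (h0 α)),
    ENNReal.ofReal_rpow_of_nonneg KnormP_nonneg hp.le]
  apply ENNReal.ofReal_le_ofReal
  unfold KnormP
  rw [← Real.rpow_mul (Finset.sum_nonneg fun γ _ => integral_nonneg (h0 γ)),
    one_div_mul_cancel hp.ne', Real.rpow_one]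
  exact Finset.single_le_sum (f := fun γ => ∫ x in ModelDomain d ℓ,
    kIntegrand d (rhoModel d ℓ) a p γ (D γ) x) (fun γ _ => integral_nonneg (h0 γ)) hα

lemma rho_ball {d ℓ : ℕ} {x₀ : Ed d} (hx₀ : x₀ ∈ ModelDomain d ℓ) {y : Ed d}
    (hy : y ∈ closedBall x₀ (3 * (rhoModel d ℓ x₀ / 8))) :
    0 < rhoModel d ℓ y ∧ rhoModel d ℓ y ≤ 2 * rhoModel d ℓ x₀ ∧
      rhoModel d ℓ x₀ ≤ 2 * rhoModel d ℓ y := by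
  have h1 := rho_lip d ℓ y x₀
  have h2 := rho_pos hx₀
  rw [mem_closedBall, dist_eq_norm] at hy
  rw [abs_le] at h1
  refine ⟨?_, ?_, ?_⟩ <;> linarith [h1.1, h1.2]

lemma int_K {d ℓ m : ℕ} {a p : ℝ} (hp : 0 < p) {u : Ed d → ℝ}
    {D : (Fin d → ℕ) → Ed d → ℝ}
    (h : KMemData d (ModelDomain d ℓ) (rhoModel d ℓ) m a p u D) {α : Fin d → ℕ}
    (hα : α ∈ multiIdx d m) {x₀ : Ed d} (hx₀ : x₀ ∈ ModelDomain d ℓ) :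
    (∫⁻ y in closedBall x₀ (3 * (rhoModel d ℓ x₀ / 8)), ‖D α y‖ₑ ^ p) ^ (1 / p) ≤
      ENNReal.ofReal (2 ^ (m + |a|) * rhoModel d ℓ x₀ ^ (a - (∑ i, α i : ℕ)) *
        KnormP d (ModelDomain d ℓ) (rhoModel d ℓ) m a p D) := by
  set ρ₀ := rhoModel d ℓ x₀ with hρ₀
  have hρ0 : 0 < ρ₀ := rho_pos hx₀
  set c : ℝ := 2 ^ (m + |a|) * ρ₀ ^ (a - (∑ i, α i : ℕ)) with hc
  have hc0 : 0 ≤ c := by positivity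
  have hsub : closedBall x₀ (3 * (ρ₀ / 8)) ⊆ ModelDomain d ℓ :=
    fun y hy => mem_model_of_rho (rho_ball hx₀ hy).1
  rw [one_div, ENNReal.rpow_inv_le_iff hp, ENNReal.ofReal_mul hc0, ENNReal.mul_rpow_of_nonneg _ _ hp.le]
  calc ∫⁻ y in closedBall x₀ (3 * (ρ₀ / 8)), ‖D α y‖ₑ ^ p
      ≤ ∫⁻ y in closedBall x₀ (3 * (ρ₀ / 8)), ENNReal.ofReal c ^ p *
        ENNReal.ofReal (kIntegrand d (rhoModel d ℓ) a p α (D α) y) := by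
        apply setLIntegral_mono' measurableSet_closedBall
        intro y hy
        obtain ⟨h1, h2, h3⟩ := rho_ball hx₀ hy
        rw [Real.enorm_eq_ofReal_abs, ENNReal.ofReal_rpow_of_nonneg (abs_nonneg _) hp.le,
          ENNReal.ofReal_rpow_of_nonneg hc0 hp.le, ← ENNReal.ofReal_mul (by positivity)]
        apply ENNReal.ofReal_le_ofReal
        unfold kIntegrand
        rw [← Real.mul_rpow hc0 (by positivity)]
        apply Real.rpow_le_rpow (abs_nonneg _) _ hp.le
        rw [← mul_assoc]
        apply le_mul_of_one_le_left (abs_nonneg _)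
        have hα' := mem_multiIdx.1 hα
        have hA : |((∑ i, α i : ℕ) : ℝ) - a| ≤ m + |a| := by
          refine (abs_sub _ _).trans ?_
          rw [abs_of_nonneg (by positivity)]
          gcongr
        have := pow_comp hρ0 h1 h3 h2 hA
        rw [hc, show a - ((∑ i, α i : ℕ) : ℝ) = -(((∑ i, α i : ℕ) : ℝ) - a) by ring,
          Real.rpow_neg hρ0.le]
        have hpos : 0 < ρ₀ ^ (((∑ i, α i : ℕ) : ℝ) - a) := Real.rpow_pos_of_pos hρ0 _
        rw [mul_right_comm, ← div_eq_mul_inv, le_div_iff₀ hpos, one_mul]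
        exact this
    _ = ENNReal.ofReal c ^ p * ∫⁻ y in closedBall x₀ (3 * (ρ₀ / 8)),
        ENNReal.ofReal (kIntegrand d (rhoModel d ℓ) a p α (D α) y) := by
        rw [lintegral_const_mul' _ _ (by finiteness)]
    _ ≤ _ := by
        gcongr
        exact (lintegral_mono_set hsub).trans (lint_le_KnormP hp h hα)

lemma vol_ball (d : ℕ) {r : ℝ} (hr : 0 < r) :
    volume (ball (0 : Ed d) r) = ENNReal.ofReal (r ^ d * (volume (ball (0 : Ed d) 1)).toReal) := by
  rw [Measure.addHaar_ball_of_pos volume _ hr, finrank_euclideanSpace_fin,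
    ENNReal.ofReal_mul (by positivity), ENNReal.ofReal_toReal measure_ball_lt_top.ne]

/-- The constant in the pointwise estimate. -/
def cst (d m k : ℕ) (a a' p C : ℝ) : ℝ :=
  2 ^ (m + |a'|) * ((1 + C) * ((∑ j ∈ Finset.range (k + 2), d ^ j : ℕ) * 2 ^ (m + |a|) *
    ((8 ^ d)⁻¹ * (volume (ball (0 : Ed d) 1)).toReal) ^ (-(1 / p))))

lemma pt_est {d ℓ m : ℕ} (hl : ℓ < d) {a a' p : ℝ} (hp : 1 ≤ p) {u : Ed d → ℝ}
    {D : (Fin d → ℕ) → Ed d → ℝ}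
    (h : KMemData d (ModelDomain d ℓ) (rhoModel d ℓ) m a p u D) {β : Fin d → ℕ} {k : ℕ}
    (hβ : ∑ i, β i + (k + 1) ≤ m) {C : ℝ} (hC : 0 ≤ C) (hT : TBound d k p (ENNReal.ofReal C))
    (ha : a' ≤ a - d / p) {x₀ : Ed d} (hx₀ : x₀ ∈ ModelDomain d ℓ) :
    ∀ᵐ x, x ∈ ball x₀ (rhoModel d ℓ x₀ / 8) →
      ‖kIntegrandInf d (rhoModel d ℓ) a' β (D β) x‖ ≤ cst d m k a a' p C *
        KnormP d (ModelDomain d ℓ) (rhoModel d ℓ) m a p D := by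
  have hp0 : 0 < p := by linarith
  set ρ₀ := rhoModel d ℓ x₀ with hρ₀
  have hρ0 : 0 < ρ₀ := rho_pos hx₀
  set N := KnormP d (ModelDomain d ℓ) (rhoModel d ℓ) m a p D with hN
  have hN0 : 0 ≤ N := KnormP_nonneg
  have hsub : closedBall x₀ (3 * (ρ₀ / 8)) ⊆ ModelDomain d ℓ :=
    fun y hy => mem_model_of_rho (rho_ball hx₀ hy).1
  set V := (volume (ball (0 : Ed d) 1)).toReal with hV
  have hV0 : 0 < V := ENNReal.toReal_pos (measure_ball_pos _ _ one_pos).ne' measure_ball_lt_top.ne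
  set v := (ρ₀ / 8) ^ d * V with hv
  have hv0 : 0 < v := by positivity
  set M : ℕ := ∑ j ∈ Finset.range (k + 2), d ^ j with hM
  set B : ℕ := ∑ i, β i with hB
  have hLB : LB d k p (ρ₀ / 8) β
      (fun α => (∫⁻ y in closedBall x₀ (3 * (ρ₀ / 8)), ‖D α y‖ₑ ^ p) ^ (1 / p)) ≤
      M * ENNReal.ofReal (v ^ (1 - 1 / p) * (2 ^ (m + |a|) * ρ₀ ^ (a - B) * N)) := by
    unfold LB
    rw [hM, Nat.cast_sum, Finset.sum_mul]
    apply Finset.sum_le_sum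
    intro j hj
    rw [Finset.mem_range] at hj
    have : ∀ w ∈ (Finset.univ : Finset (Fin j → Fin d)), ENNReal.ofReal ((ρ₀ / 8) ^ j) *
      (volume (ball (0 : Ed d) (ρ₀ / 8)) ^ (1 - 1 / p) * (∫⁻ y in closedBall x₀ (3 * (ρ₀ / 8)),
        ‖D (fun i => β i + (List.ofFn w).count i) y‖ₑ ^ p) ^ (1 / p)) ≤
      ENNReal.ofReal (v ^ (1 - 1 / p) * (2 ^ (m + |a|) * ρ₀ ^ (a - B) * N)) := by
      intro w _
      have hk := int_K hp0 h (mem_multiIdx_add hβ (show j ≤ k + 1 by omega) w) hx₀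
      have hs : ∑ i, (β i + (List.ofFn w).count i) = B + j := by
        rw [Finset.sum_add_distrib, sum_count, List.length_ofFn]
      rw [hs] at hk
      refine (mul_le_mul' le_rfl (mul_le_mul' le_rfl hk)).trans ?_
      rw [vol_ball d (by positivity), ENNReal.ofReal_rpow_of_pos (by positivity),
        ← ENNReal.ofReal_mul (by positivity), ← ENNReal.ofReal_mul (by positivity)]
      apply ENNReal.ofReal_le_ofReal
      have e : ρ₀ ^ (a - ((B + j : ℕ) : ℝ)) * ρ₀ ^ j = ρ₀ ^ (a - B) := by
        rw [← Real.rpow_natCast ρ₀ j, ← Real.rpow_add hρ0]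
        congr 1
        push_cast; ring
      have e2 : (ρ₀ / 8) ^ j ≤ ρ₀ ^ j := by
        apply pow_le_pow_left₀ (by positivity); linarith
      calc (ρ₀ / 8) ^ j * (v ^ (1 - 1 / p) *
            (2 ^ (m + |a|) * ρ₀ ^ (a - ((B + j : ℕ) : ℝ)) * N))
          ≤ ρ₀ ^ j * (v ^ (1 - 1 / p) * (2 ^ (m + |a|) * ρ₀ ^ (a - ((B + j : ℕ) : ℝ)) * N)) := by
            gcongr
        _ = _ := by rw [← e]; ring
    refine (Finset.sum_le_sum this).trans (le_of_eq ?_)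
    simp
  filter_upwards [local_est hl h.1 (by positivity : 0 < ρ₀ / 8) hsub hβ hp hT] with x hx hxb
  have hx1 := (hx hxb).trans (mul_le_mul' le_rfl hLB)
  rw [vol_ball d (by positivity), Real.enorm_eq_ofReal_abs, ← ENNReal.ofReal_mul hv0.le,
    ← ENNReal.ofReal_one, ← ENNReal.ofReal_add zero_le_one hC, ← ENNReal.ofReal_natCast,
    ← ENNReal.ofReal_mul (by positivity), ← ENNReal.ofReal_mul (by positivity),
    ENNReal.ofReal_le_ofReal_iff (by positivity)] at hx1
  obtain ⟨h1, h2, h3⟩ := rho_ball hx₀ (ball_subset_closedBall.trans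
    (closedBall_subset_closedBall (by linarith)) hxb)
  have hA : |((∑ i, β i : ℕ) : ℝ) - a'| ≤ m + |a'| := by
    refine (abs_sub _ _).trans ?_
    rw [abs_of_nonneg (by positivity)]
    gcongr
    omega
  have hw := pow_comp h1 hρ0 h2 h3 hA
  have hx2 : |D β x| ≤ (1 + C) * (M * (2 ^ (m + |a|) * v ^ (-(1 / p)) * ρ₀ ^ (a - B) * N)) := by
    have e : v ^ (1 - 1 / p) = v * v ^ (-(1 / p)) := by
      rw [sub_eq_add_neg, Real.rpow_add hv0, Real.rpow_one]
    rw [e] at hx1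
    have : v * |D β x| ≤ v * ((1 + C) * (M * (2 ^ (m + |a|) * v ^ (-(1 / p)) *
        ρ₀ ^ (a - B) * N))) := by
      refine hx1.trans (le_of_eq ?_)
      ring
    exact le_of_mul_le_mul_left this hv0
  unfold kIntegrandInf
  rw [norm_mul, Real.norm_eq_abs, Real.norm_eq_abs, abs_of_pos (Real.rpow_pos_of_pos h1 _)]
  refine (mul_le_mul hw hx2 (abs_nonneg _) (by positivity)).trans ?_
  have ev : v ^ (-(1 / p)) = ρ₀ ^ (-(d / p)) * ((8 ^ d)⁻¹ * V) ^ (-(1 / p)) := by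
    rw [hv, div_pow, div_eq_mul_inv, mul_assoc, Real.mul_rpow (by positivity) (by positivity),
      ← Real.rpow_natCast ρ₀ d, ← Real.rpow_mul hρ0.le]
    congr 2
    ring
  have e3 : ρ₀ ^ ((B : ℝ) - a') * (ρ₀ ^ (-(d / p)) * ρ₀ ^ (a - B)) ≤ 1 := by
    rw [← Real.rpow_add hρ0, ← Real.rpow_add hρ0]
    apply Real.rpow_le_one hρ0.le (rho_le_one _ _ _)
    linarith
  rw [ev]
  unfold cst
  calc _ = (ρ₀ ^ ((B : ℝ) - a') * (ρ₀ ^ (-(d / p)) * ρ₀ ^ (a - B))) *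
        (2 ^ (m + |a'|) * ((1 + C) * (M * 2 ^ (m + |a|) *
    ((8 ^ d)⁻¹ * V) ^ (-(1 / p)))) * N) := by ring
    _ ≤ _ := mul_le_of_le_one_left (by positivity) e3

lemma ae_of_local {d : ℕ} {Ω : Set (Ed d)} {P : Ed d → Prop}
    (h : ∀ x₀ ∈ Ω, ∃ r > 0, ∀ᵐ x, x ∈ ball x₀ r → P x) : ∀ᵐ x, x ∈ Ω → P x := by
  rw [ae_iff]
  apply measure_null_of_locally_null
  intro x₀ hx₀
  simp only [Classical.not_imp, mem_ofPred_eq] at hx₀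
  obtain ⟨r, hr, hP⟩ := h x₀ hx₀.1
  refine ⟨_, inter_mem_nhdsWithin _ (ball_mem_nhds x₀ hr), ?_⟩
  rw [ae_iff] at hP
  refine measure_mono_null ?_ hP
  rintro x ⟨hx, hxb⟩
  simp only [Classical.not_imp, mem_ofPred_eq] at hx ⊢
  exact ⟨hxb, hx.2⟩

lemma suff_core {d ℓ m m' : ℕ} (hl : ℓ < d) {a a' p : ℝ} (hp : 1 ≤ p) (ha : a' ≤ a - d / p)
    (hm : m' < m) (hT : ∀ b ≤ m', ∃ C : ℝ, 0 ≤ C ∧ TBound d (m - b - 1) p (ENNReal.ofReal C)) :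
    ∃ c : ℝ, 0 < c ∧ ∀ u : Ed d → ℝ, MemKM d ℓ m a p u →
          MemKMInf d ℓ m' a' u ∧ KnormMInf d ℓ m' a' u ≤ c * KnormM d ℓ m a p u := by
  choose! C hC hTC using hT
  set Ks : (Fin d → ℕ) → ℝ := fun β => cst d m (m - (∑ i, β i) - 1) a a' p (C (∑ i, β i)) with hKs
  have hKs0 : ∀ β ∈ multiIdx d m', 0 ≤ Ks β := by
    intro β hβ
    have := hC _ (mem_multiIdx.1 hβ)
    simp only [hKs, cst]
    positivity
  have hS : 0 ≤ ∑ β ∈ multiIdx d m', Ks β := Finset.sum_nonneg hKs0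
  refine ⟨∑ β ∈ multiIdx d m', Ks β + 1, by positivity, ?_⟩
  rintro u ⟨D, hD⟩
  have hfam : IsWeakDerivFamily d (ModelDomain d ℓ) m' u D := by
    intro α hα
    apply hD.1
    rw [mem_multiIdx] at *
    omega
  set N := KnormP d (ModelDomain d ℓ) (rhoModel d ℓ) m a p D with hN
  have hN0 : 0 ≤ N := KnormP_nonneg
  have hb : ∀ β ∈ multiIdx d m', eLpNorm (kIntegrandInf d (rhoModel d ℓ) a' β (D β)) ⊤
      (volume.restrict (ModelDomain d ℓ)) ≤ ENNReal.ofReal (Ks β * N) := by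
    intro β hβ
    have hβ' := mem_multiIdx.1 hβ
    have hae : ∀ᵐ x, x ∈ ModelDomain d ℓ →
        ‖kIntegrandInf d (rhoModel d ℓ) a' β (D β) x‖ ≤ Ks β * N := by
      apply ae_of_local
      intro x₀ hx₀
      refine ⟨_, div_pos (rho_pos hx₀) (by norm_num : (0 : ℝ) < 8), ?_⟩
      exact pt_est hl hp hD (by omega) (hC _ hβ') (hTC _ hβ') ha hx₀
    rw [← ae_restrict_iff' (isOpen_model d ℓ).measurableSet] at hae
    have := eLpNorm_le_of_ae_bound (p := ⊤) hae
    simpa using this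
  have hmem : MemKMInf d ℓ m' a' u :=
    ⟨D, hfam, fun α hα => (hb α hα).trans_lt ENNReal.ofReal_lt_top⟩
  refine ⟨hmem, ?_⟩
  rw [KnormMInf_eq hl hfam hmem, KnormM_eq hl hD]
  unfold KnormInfP
  calc _ ≤ ∑ β ∈ multiIdx d m', Ks β * N := by
        apply Finset.sum_le_sum
        intro β hβ
        apply ENNReal.toReal_le_of_le_ofReal (mul_nonneg (hKs0 β hβ) hN0) (hb β hβ)
    _ = (∑ β ∈ multiIdx d m', Ks β) * N := by rw [Finset.sum_mul]
    _ ≤ _ := by gcongr; linarith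

lemma suff_gt {d ℓ m m' : ℕ} (hl : ℓ < d) {a a' p : ℝ} (hp : 1 < p) (ha : a' ≤ a - d / p)
    (hm : (m' : ℝ) < m - d / p) :
    ∃ c : ℝ, 0 < c ∧ ∀ u : Ed d → ℝ, MemKM d ℓ m a p u →
          MemKMInf d ℓ m' a' u ∧ KnormMInf d ℓ m' a' u ≤ c * KnormM d ℓ m a p u := by
  have h0 : (0 : ℝ) ≤ d / p := by positivity
  have hmm : m' < m := by exact_mod_cast (by linarith : (m' : ℝ) < m)
  refine suff_core hl hp.le ha hmm fun b hb => ?_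
  have hk : ((m - b - 1 : ℕ) : ℝ) = m - b - 1 := by
    rw [Nat.cast_sub (by omega), Nat.cast_sub (by omega)]; simp
  have hb' : (b : ℝ) ≤ m' := by exact_mod_cast hb
  refine ⟨_, ?_, tbound_A hp.le ?_⟩
  · rw [hk]; apply one_div_nonneg.2; linarith
  · rw [hk]; linarith

lemma suff_one {d ℓ m m' : ℕ} (hl : ℓ < d) {a a' : ℝ} (ha : a' ≤ a - d)
    (hm : (m' : ℝ) ≤ m - d) :
    ∃ c : ℝ, 0 < c ∧ ∀ u : Ed d → ℝ, MemKM d ℓ m a 1 u →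
          MemKMInf d ℓ m' a' u ∧ KnormMInf d ℓ m' a' u ≤ c * KnormM d ℓ m a 1 u := by
  have hmm : m' + d ≤ m := by exact_mod_cast (by linarith : (m' : ℝ) + d ≤ m)
  refine suff_core hl le_rfl (by simpa using ha) (by omega) fun b hb => ?_
  exact ⟨_, by positivity, tbound_B (by omega) (by omega)⟩


/-! ### Necessity: test functions -/

/-- The continuous embedding. -/
def Emb (d ℓ m m' : ℕ) (a a' p c : ℝ) : Prop :=
  ∀ u : Ed d → ℝ, MemKM d ℓ m a p u →
    MemKMInf d ℓ m' a' u ∧ KnormMInf d ℓ m' a' u ≤ c * KnormM d ℓ m a p u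

lemma test_mem {d ℓ : ℕ} (hl : ℓ < d) (m : ℕ) (a : ℝ) {p : ℝ} (hp : 0 < p) {u : Ed d → ℝ}
    (hu : IsTestFun d (ModelDomain d ℓ) u) :
    KMemData d (ModelDomain d ℓ) (rhoModel d ℓ) m a p u (fun α => pderivA d α u) := by
  refine ⟨fun α _ => smooth_weak hl α hu.1, fun α _ => ?_⟩
  rw [IntegrableOn, restrict_model d ℓ hl]
  have hsupp : Function.support (kIntegrand d (rhoModel d ℓ) a p α (pderivA d α u)) ⊆
      tsupport u := by
    intro x hx
    by_contra hxs
    apply hx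
    have : pderivA d α u x = 0 :=
      image_eq_zero_of_notMem_tsupport fun h => hxs (tsupport_pderivA α u h)
    simp [kIntegrand, this, hp.ne']
  rw [← integrableOn_iff_integrable_of_support_subset hsupp]
  apply ContinuousOn.integrableOn_compact hu.2.1.isCompact
  have hc := (smooth_pderivA α hu.1).continuous
  apply ContinuousOn.rpow_const _ (fun x _ => Or.inr hp.le)
  apply ContinuousOn.mul _ hc.abs.continuousOn
  apply ContinuousOn.rpow_const (continuous_rho d ℓ).continuousOn
  exact fun x hx => Or.inl (rho_pos (hu.2.2 hx)).ne'

lemma test_ineq {d ℓ m m' : ℕ} (hl : ℓ < d) {a a' p c : ℝ} (hp : 0 < p)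
    (hE : Emb d ℓ m m' a a' p c) {u : Ed d → ℝ}
    (hu : IsTestFun d (ModelDomain d ℓ) u) {β : Fin d → ℕ} (hβ : β ∈ multiIdx d m') {x : Ed d}
    (hx : x ∈ ModelDomain d ℓ) :
    rhoModel d ℓ x ^ (((∑ i, β i : ℕ) : ℝ) - a') * |pderivA d β u x| ≤
      c * (∑ α ∈ multiIdx d m, ∫ y, kIntegrand d (rhoModel d ℓ) a p α (pderivA d α u) y)
        ^ (1 / p) := by
  have hmem := test_mem hl m a hp hu
  obtain ⟨h1, h2⟩ := hE u ⟨_, hmem⟩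
  have hfam : IsWeakDerivFamily d (ModelDomain d ℓ) m' u (fun α => pderivA d α u) :=
    fun α _ => smooth_weak hl α hu.1
  rw [KnormMInf_eq hl hfam h1, KnormM_eq hl hmem] at h2
  unfold KnormP at h2
  rw [restrict_model d ℓ hl] at h2
  refine le_trans ?_ h2
  have hlt := (KMemDataInf_of hl hfam h1).2 β hβ
  set g := kIntegrandInf d (rhoModel d ℓ) a' β (pderivA d β u) with hg
  set B := (eLpNorm g ⊤ (volume.restrict (ModelDomain d ℓ))).toReal with hB
  have hle : B ≤ KnormInfP d (ModelDomain d ℓ) (rhoModel d ℓ) m' a' (fun α => pderivA d α u) :=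
    Finset.single_le_sum (f := fun α => (eLpNorm (kIntegrandInf d (rhoModel d ℓ) a' α
      (pderivA d α u)) ⊤ (volume.restrict (ModelDomain d ℓ))).toReal)
      (fun _ _ => ENNReal.toReal_nonneg) hβ
  refine le_trans ?_ hle
  have hgc : ContinuousOn g (ModelDomain d ℓ) := by
    apply ContinuousOn.mul _ (smooth_pderivA β hu.1).continuous.continuousOn
    apply ContinuousOn.rpow_const (continuous_rho d ℓ).continuousOn
    exact fun x hx => Or.inl (rho_pos hx).ne'
  have hae : ∀ᵐ y, ‖g y‖ ≤ B := by
    have := ae_le_eLpNormEssSup (f := g) (μ := volume.restrict (ModelDomain d ℓ))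
    rw [restrict_model d ℓ hl] at this hlt
    rw [restrict_model d ℓ hl] at hB
    filter_upwards [this] with y hy
    rw [hB, ← toReal_enorm]
    rw [eLpNorm_exponent_top] at hlt ⊢
    exact ENNReal.toReal_mono hlt.ne hy
  have hopen : IsOpen (ModelDomain d ℓ ∩ (fun y => ‖g y‖) ⁻¹' Ioi B) :=
    hgc.norm.isOpen_inter_preimage (isOpen_model d ℓ) isOpen_Ioi
  have hnull : volume (ModelDomain d ℓ ∩ (fun y => ‖g y‖) ⁻¹' Ioi B) = 0 := by
    rw [ae_iff] at hae
    refine measure_mono_null ?_ hae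
    rintro y ⟨_, hy⟩
    simpa using hy
  rw [hopen.measure_eq_zero_iff (μ := volume)] at hnull
  have : ‖g x‖ ≤ B := by
    by_contra hcon
    have : x ∈ ModelDomain d ℓ ∩ (fun y => ‖g y‖) ⁻¹' Ioi B := ⟨hx, not_le.1 hcon⟩
    rw [hnull] at this
    exact this
  refine le_trans (le_of_eq ?_) this
  rw [hg]
  unfold kIntegrandInf
  rw [norm_mul, Real.norm_eq_abs, Real.norm_eq_abs,
    abs_of_pos (Real.rpow_pos_of_pos (rho_pos hx) _)]

lemma nrm'_single {d ℓ : ℕ} (hl : ℓ < d) {t : ℝ} (ht : 0 ≤ t) :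
    nrm' d ℓ (EuclideanSpace.single ⟨0, by omega⟩ t) = t := by
  unfold nrm'
  rw [Finset.sum_eq_single_of_mem ⟨0, by omega⟩]
  · simp [ht]
  · simp; omega
  · intro b _ hb
    simp [hb]

lemma pderivA_zero {d : ℕ} (u : Ed d → ℝ) (hu : Smooth d u) : pderivA d (fun _ => 0) u = u := by
  have := wd_eq_pderivA [] hu
  simpa [wd_nil] using this.symm

lemma nec_a {d ℓ m m' : ℕ} (hl : ℓ < d) {a a' p c : ℝ} (hp : 0 < p)
    (hE : Emb d ℓ m m' a a' p c) : a' ≤ a - d / p := by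
  set x₁ : Ed d := EuclideanSpace.single ⟨0, by omega⟩ 2 with hx₁
  have hn1 : nrm' d ℓ x₁ = 2 := nrm'_single hl (by norm_num)
  let φ : ContDiffBump x₁ := ⟨1 / 2, 1, by norm_num, by norm_num⟩
  have hφs : Smooth d φ := φ.contDiff
  have hts : tsupport φ = closedBall x₁ 1 := φ.tsupport_eq
  have hφn : ∀ y ∈ closedBall x₁ 1, 1 ≤ nrm' d ℓ y ∧ nrm' d ℓ y ≤ 3 := by
    intro y hy
    have := nrm'_lip d ℓ y x₁
    rw [mem_closedBall, dist_eq_norm] at hy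
    rw [hn1, abs_le] at this
    constructor <;> linarith [this.1, this.2]
  set H : (Fin d → ℕ) → Ed d → ℝ := fun α y =>
    (nrm' d ℓ y ^ (((∑ i, α i : ℕ) : ℝ) - a) * |pderivA d α φ y|) ^ p with hH
  set S := (∑ α ∈ multiIdx d m, ∫ y, H α y) ^ (1 / p) with hS
  have key : ∀ t : ℝ, 4 ≤ t → 2 ^ (-a') * t ^ a' ≤ c * (t ^ (a - d / p) * S) := by
    intro t ht
    have ht0 : 0 < t := by linarith
    set u : Ed d → ℝ := fun x => φ (t • (x - 0)) with hu
    have hus : Smooth d u := smooth_scale hφs t 0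
    have hsupp : tsupport u ⊆ closedBall (t⁻¹ • x₁) t⁻¹ := by
      apply closure_minimal _ isClosed_closedBall
      intro y hy
      have hy' : t • (y - 0) ∈ closedBall x₁ 1 := hts ▸ subset_tsupport φ hy
      rw [sub_zero, mem_closedBall, dist_eq_norm] at hy'
      rw [mem_closedBall, dist_eq_norm]
      have : y - t⁻¹ • x₁ = t⁻¹ • (t • y - x₁) := by
        rw [smul_sub, inv_smul_smul₀ ht0.ne']
      rw [this, norm_smul, Real.norm_of_nonneg (by positivity)]
      exact mul_le_of_le_one_right (by positivity) hy'
    have hback : ∀ y ∈ closedBall (t⁻¹ • x₁) t⁻¹, t • y ∈ closedBall x₁ 1 := by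
      intro y hy
      rw [mem_closedBall, dist_eq_norm] at *
      have : t • y - x₁ = t • (y - t⁻¹ • x₁) := by
        rw [smul_sub, smul_inv_smul₀ ht0.ne']
      rw [this, norm_smul, Real.norm_of_nonneg ht0.le]
      calc t * _ ≤ t * t⁻¹ := by gcongr
        _ = 1 := mul_inv_cancel₀ ht0.ne'
    have htest : IsTestFun d (ModelDomain d ℓ) u := by
      refine ⟨hus, (isCompact_closedBall _ _).of_isClosed_subset isClosed_closure hsupp, ?_⟩
      intro y hy
      have := (hφn _ (hback y (hsupp hy))).1
      rw [nrm'_smul d ℓ t ht0.le] at this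
      rw [nrm'_pos]
      by_contra hcon
      nlinarith
    have hk : ∀ α, ∫ y, kIntegrand d (rhoModel d ℓ) a p α (pderivA d α u) y =
        (t ^ (a - d / p)) ^ p * ∫ y, H α y := by
      intro α
      have e1 : ∀ y, kIntegrand d (rhoModel d ℓ) a p α (pderivA d α u) y =
          (t ^ a) ^ p * H α (t • y) := by
        intro y
        unfold kIntegrand
        simp only [hH]
        rw [hu, pderivA_scale α hφs t 0]
        simp only [sub_zero]
        by_cases h0 : pderivA d α φ (t • y) = 0
        · simp [h0, hp.ne']
        · have hmem : t • y ∈ closedBall x₁ 1 :=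
            hts ▸ tsupport_pderivA α φ (subset_tsupport _ h0)
          obtain ⟨h1, h3⟩ := hφn _ hmem
          rw [nrm'_smul d ℓ t ht0.le] at h1 h3 ⊢
          have hr0 : 0 < nrm' d ℓ y := by
            by_contra hcon
            nlinarith
          have hr : rhoModel d ℓ y = nrm' d ℓ y := by
            rw [rho_eq]; apply min_eq_right; nlinarith
          rw [hr, ← Real.mul_rpow (by positivity) (by positivity), abs_mul,
            abs_of_pos (pow_pos ht0 _), Real.mul_rpow ht0.le hr0.le, Real.rpow_sub ht0,
            Real.rpow_natCast]
          congr 1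
          have : t ^ a ≠ 0 := (Real.rpow_pos_of_pos ht0 a).ne'
          field_simp
      simp_rw [e1]
      rw [integral_const_mul, Measure.integral_comp_smul, finrank_euclideanSpace_fin,
        abs_of_pos (by positivity), smul_eq_mul, ← mul_assoc]
      congr 1
      rw [← Real.rpow_mul ht0.le, ← Real.rpow_mul ht0.le, sub_mul, div_mul_cancel₀ _ hp.ne',
        Real.rpow_sub ht0, Real.rpow_natCast, div_eq_mul_inv]
    have hn : nrm' d ℓ (t⁻¹ • x₁) = 2 / t := by
      rw [nrm'_smul d ℓ _ (by positivity), hn1]; field_simp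
    have hmain := test_ineq hl hp hE htest (β := fun _ => 0) (by simp [mem_multiIdx])
      (x := t⁻¹ • x₁) (by rw [nrm'_pos, hn]; positivity)
    simp_rw [hk] at hmain
    rw [← Finset.mul_sum, Real.mul_rpow (by positivity)
      (Finset.sum_nonneg fun α _ => integral_nonneg fun y => by
        simp only [hH]
        exact Real.rpow_nonneg (mul_nonneg (Real.rpow_nonneg (Real.sqrt_nonneg _) _)
          (abs_nonneg _)) _),
      ← Real.rpow_mul (by positivity), mul_one_div_cancel hp.ne', Real.rpow_one,
      pderivA_zero u hus, rho_eq, hn, min_eq_right (by rw [div_le_one ht0]; linarith)] at hmain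
    have hval : u (t⁻¹ • x₁) = 1 := by
      simp only [hu, sub_zero]
      rw [smul_inv_smul₀ ht0.ne']
      exact φ.one_of_mem_closedBall (mem_closedBall_self φ.rIn_pos.le)
    rw [hval] at hmain
    simp only [Finset.sum_const_zero, Nat.cast_zero, zero_sub, abs_one, mul_one] at hmain
    rw [Real.div_rpow (by norm_num) ht0.le, Real.rpow_neg ht0.le, div_inv_eq_mul] at hmain
    exact hmain
  by_contra hcon
  push Not at hcon
  have hlim := tendsto_rpow_atTop (show 0 < a' - (a - d / p) by linarith)
  obtain ⟨t, ht, ht4⟩ := ((hlim.eventually_gt_atTop (c * S / 2 ^ (-a'))).and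
    (eventually_ge_atTop 4)).exists
  have ht0 : (0 : ℝ) < t := by linarith
  have h1 := key t ht4
  have h2 : (0 : ℝ) < 2 ^ (-a') := by positivity
  have h3 : 0 < t ^ (a - d / p) := by positivity
  rw [div_lt_iff₀ h2, Real.rpow_sub ht0, div_mul_eq_mul_div, lt_div_iff₀ h3] at ht
  nlinarith


/-! ### Necessity of the smoothness condition -/

/-- The normalized monomial `x_i^k / k!`. -/
def mono (d : ℕ) (i : Fin d) (k : ℕ) : Ed d → ℝ := fun x => (x i) ^ k / (k.factorial : ℝ)

lemma smooth_mono {d : ℕ} (i : Fin d) (k : ℕ) : Smooth d (mono d i k) := by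
  unfold Smooth mono
  fun_prop

lemma pderivI_mono_zero {d : ℕ} (i j : Fin d) : pderivI d j (mono d i 0) = 0 := by
  funext x
  unfold pderivI mono
  simp

lemma pderivI_mono_succ {d : ℕ} (i j : Fin d) (k : ℕ) :
    pderivI d j (mono d i (k + 1)) = if j = i then mono d i k else 0 := by
  funext x
  have h0 : HasFDerivAt (fun y : Ed d => y i) (EuclideanSpace.proj i : Ed d →L[ℝ] ℝ) x :=
    (EuclideanSpace.proj i : Ed d →L[ℝ] ℝ).hasFDerivAt
  have h1 := (h0.pow (k + 1)).mul_const (((k + 1).factorial : ℝ)⁻¹)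
  have h2 : fderiv ℝ (mono d i (k + 1)) x = _ := h1.fderiv
  unfold pderivI
  rw [h2]
  by_cases h : j = i
  · subst h
    simp [mono, Nat.factorial_succ]
    field_simp
  · simp [h, Ne.symm h]

lemma pderivI_zero {d : ℕ} (j : Fin d) : pderivI d j 0 = 0 := by
  funext x
  unfold pderivI
  simp

lemma wd_mono {d : ℕ} (i : Fin d) (k : ℕ) (w : List (Fin d)) :
    wd d w (mono d i k) = 0 ∨ ∃ j, j + w.length = k ∧ wd d w (mono d i k) = mono d i j := by
  induction w with
  | nil => exact Or.inr ⟨k, by simp, rfl⟩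
  | cons b w ih =>
    rw [wd_cons]
    rcases ih with h | ⟨j, hj, h⟩
    · left; rw [h, pderivI_zero]
    · rw [h]
      cases j with
      | zero => left; exact pderivI_mono_zero i b
      | succ j =>
        rw [pderivI_mono_succ]
        by_cases hb : b = i
        · right
          refine ⟨j, ?_, by simp [hb]⟩
          simp only [List.length_cons]; omega
        · left; simp [hb]

lemma wd_mono_replicate {d : ℕ} (i : Fin d) (k n : ℕ) :
    wd d (List.replicate n i) (mono d i (k + n)) = mono d i k := by
  induction n generalizing k with
  | zero => rfl
  | succ n ih =>
    rw [List.replicate_succ, wd_cons, show k + (n + 1) = (k + 1) + n by ring, ih,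
      pderivI_mono_succ, if_pos rfl]

/-- The profile function. -/
lemma exists_profile {d : ℕ} (i : Fin d) (k : ℕ) : ∃ φ : Ed d → ℝ, Smooth d φ ∧
    tsupport φ ⊆ closedBall 0 (3 / 4) ∧
    (∃ β : Fin d → ℕ, ∑ j, β j = k ∧ pderivA d β φ 0 = 1) ∧
    ∀ α : Fin d → ℕ, k < ∑ j, α j → ∀ x, pderivA d α φ x ≠ 0 → 1 / 2 ≤ ‖x‖ := by
  let χ : ContDiffBump (0 : Ed d) := ⟨1 / 2, 3 / 4, by norm_num, by norm_num⟩
  have hχs : Smooth d χ := χ.contDiff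
  have hs : Smooth d (fun x => mono d i k x * χ x) := (smooth_mono i k).mul hχs
  have hloc : ∀ x : Ed d, ‖x‖ < 1 / 2 →
      (fun x => mono d i k x * χ x) =ᶠ[𝓝 x] mono d i k := by
    intro x hx
    have : ball (0 : Ed d) (1 / 2) ∈ 𝓝 x := isOpen_ball.mem_nhds (by simpa using hx)
    filter_upwards [this] with y hy
    have : χ y = 1 := χ.one_of_mem_closedBall (ball_subset_closedBall hy)
    simp [this]
  refine ⟨fun x => mono d i k x * χ x, hs, ?_, ⟨fun j => (List.replicate k i).count j, ?_, ?_⟩, ?_⟩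
  · refine (tsupport_mul_subset_right (f := mono d i k) (g := χ)).trans ?_
    rw [χ.tsupport_eq]
  · rw [sum_count, List.length_replicate]
  · rw [← wd_eq_pderivA _ hs, (wd_congr_nhds _ (hloc 0 (by simp))).self_of_nhds]
    have := wd_mono_replicate i 0 k
    rw [zero_add] at this
    rw [this]
    simp [mono]
  · intro α hα x hx
    by_contra hlt
    apply hx
    rw [pderivA_eq_wd, (wd_congr_nhds _ (hloc x (not_le.1 hlt))).self_of_nhds]
    rcases wd_mono i k (wordOf d α) with h | ⟨j, hj, _⟩
    · rw [h]; rfl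
    · rw [length_wordOf] at hj; omega

/-- The lacunary sum. -/
def lac (d k N : ℕ) (φ : Ed d → ℝ) (x₀ : Ed d) : Ed d → ℝ := fun x =>
  ∑ n ∈ Finset.range N, (((2 : ℝ) ^ n) ^ k)⁻¹ * φ ((2 : ℝ) ^ n • (x - x₀))

lemma smooth_lac_term {d k : ℕ} {φ : Ed d → ℝ} (hφ : Smooth d φ) (x₀ : Ed d) (n : ℕ) :
    Smooth d fun x => (((2 : ℝ) ^ n) ^ k)⁻¹ * φ ((2 : ℝ) ^ n • (x - x₀)) :=
  contDiff_const.mul (smooth_scale hφ _ _)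

lemma pderivA_lac {d k N : ℕ} {φ : Ed d → ℝ} (hφ : Smooth d φ) (x₀ : Ed d) (α : Fin d → ℕ) :
    pderivA d α (lac d k N φ x₀) = fun x => ∑ n ∈ Finset.range N,
      (((2 : ℝ) ^ n) ^ k)⁻¹ * (((2 : ℝ) ^ n) ^ (∑ i, α i) *
        pderivA d α φ ((2 : ℝ) ^ n • (x - x₀))) := by
  unfold lac
  rw [pderivA_sum α _ _ (smooth_lac_term hφ x₀)]
  funext x
  refine Finset.sum_congr rfl fun n _ => ?_
  rw [pderivA_const_mul α (smooth_scale hφ _ _), pderivA_scale α hφ]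

lemma tsupport_lac {d k N : ℕ} {φ : Ed d → ℝ} (hs : tsupport φ ⊆ closedBall 0 (3 / 4))
    (x₀ : Ed d) : tsupport (lac d k N φ x₀) ⊆ closedBall x₀ 1 := by
  apply closure_minimal _ isClosed_closedBall
  intro x hx
  obtain ⟨n, _, hn⟩ := Finset.exists_ne_zero_of_sum_ne_zero hx
  have hn' : φ ((2 : ℝ) ^ n • (x - x₀)) ≠ 0 := right_ne_zero_of_mul hn
  have := hs (subset_tsupport φ hn')
  rw [mem_closedBall_zero_iff, norm_smul, Real.norm_of_nonneg (by positivity)] at this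
  rw [mem_closedBall, dist_eq_norm]
  have h2 : (1 : ℝ) ≤ 2 ^ n := one_le_pow₀ (by norm_num)
  nlinarith [norm_nonneg (x - x₀)]

/-- The scaled terms. -/
def lt' (d k : ℕ) (φ : Ed d → ℝ) (x₀ : Ed d) (α : Fin d → ℕ) (n : ℕ) (x : Ed d) : ℝ :=
  (((2 : ℝ) ^ n) ^ k)⁻¹ * (((2 : ℝ) ^ n) ^ (∑ i, α i) *
        pderivA d α φ ((2 : ℝ) ^ n • (x - x₀)))

lemma int_lt {d k : ℕ} {φ : Ed d → ℝ} (x₀ : Ed d) (α : Fin d → ℕ) (n : ℕ) {p : ℝ} (hp : 0 < p) :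
    ∫ x, |lt' d k φ x₀ α n x| ^ p =
      ((2 : ℝ) ^ n) ^ (((∑ i, α i : ℕ) - k : ℝ) * p - d) * ∫ x, |pderivA d α φ x| ^ p := by
  set s : ℝ := 2 ^ n with hs
  have hs0 : 0 < s := by positivity
  have e : ∀ x, |lt' d k φ x₀ α n x| ^ p = ((s ^ k)⁻¹ * s ^ (∑ i, α i)) ^ p *
      (fun y => |pderivA d α φ (s • y)| ^ p) (x - x₀) := by
    intro x
    unfold lt'
    rw [← mul_assoc, abs_mul, Real.mul_rpow (abs_nonneg _) (abs_nonneg _),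
      abs_of_pos (by positivity)]
  simp_rw [e]
  rw [integral_const_mul, integral_sub_right_eq_self (fun y => |pderivA d α φ (s • y)| ^ p),
    Measure.integral_comp_smul volume (fun y => |pderivA d α φ y| ^ p),
    finrank_euclideanSpace_fin,
    abs_of_pos (by positivity), smul_eq_mul, ← mul_assoc]
  congr 1
  rw [Real.rpow_sub hs0, Real.rpow_mul hs0.le, Real.rpow_sub hs0, Real.rpow_natCast,
    Real.rpow_natCast, Real.rpow_natCast, div_eq_mul_inv, div_eq_mul_inv, mul_comm (s ^ k)⁻¹]

lemma integrable_lt {d k : ℕ} {φ : Ed d → ℝ} (hφ : Smooth d φ)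
    (hs : tsupport φ ⊆ closedBall 0 (3 / 4)) (x₀ : Ed d) (α : Fin d → ℕ) (n : ℕ) {p : ℝ}
    (hp : 0 < p) : Integrable fun x => |lt' d k φ x₀ α n x| ^ p := by
  apply Continuous.integrable_of_hasCompactSupport
  · have hc := (smooth_pderivA α hφ).continuous
    have : Continuous (lt' d k φ x₀ α n) := by unfold lt'; fun_prop
    exact this.abs.rpow_const fun x => Or.inr hp.le
  · refine HasCompactSupport.intro (isCompact_closedBall x₀ 1) ?_
    intro x hx
    have : pderivA d α φ ((2 : ℝ) ^ n • (x - x₀)) = 0 := by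
      by_contra h
      have := hs (tsupport_pderivA α φ (subset_tsupport _ h))
      rw [mem_closedBall_zero_iff, norm_smul, Real.norm_of_nonneg (by positivity)] at this
      apply hx
      rw [mem_closedBall, dist_eq_norm]
      have h2 : (1 : ℝ) ≤ 2 ^ n := one_le_pow₀ (by norm_num)
      nlinarith [norm_nonneg (x - x₀)]
    simp [lt', this, hp.ne']

lemma int_lac_le {d k N : ℕ} {φ : Ed d → ℝ} (hφ : Smooth d φ)
    (hs : tsupport φ ⊆ closedBall 0 (3 / 4)) (x₀ : Ed d) (α : Fin d → ℕ) {p : ℝ}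
    (hp : 0 < p) {κ : ℝ} (hκ : ∀ x, |∑ n ∈ Finset.range N, lt' d k φ x₀ α n x| ^ p ≤
      κ * ∑ n ∈ Finset.range N, |lt' d k φ x₀ α n x| ^ p) :
    ∫ x, |pderivA d α (lac d k N φ x₀) x| ^ p ≤ κ * ((∑ n ∈ Finset.range N,
      ((2 : ℝ) ^ n) ^ (((∑ i, α i : ℕ) - k : ℝ) * p - d)) * ∫ x, |pderivA d α φ x| ^ p) := by
  rw [pderivA_lac hφ]
  calc ∫ x, |∑ n ∈ Finset.range N, lt' d k φ x₀ α n x| ^ p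
      ≤ ∫ x, κ * ∑ n ∈ Finset.range N, |lt' d k φ x₀ α n x| ^ p := by
        apply integral_mono_of_nonneg (Eventually.of_forall fun x => by positivity)
        · exact (integrable_finsetSum _ fun n _ => integrable_lt hφ hs x₀ α n hp).const_mul κ
        · exact Eventually.of_forall hκ
    _ = _ := by
        rw [integral_const_mul, integral_finsetSum _ fun n _ => integrable_lt hφ hs x₀ α n hp]
        simp_rw [int_lt x₀ α _ hp]
        rw [Finset.sum_mul]

lemma kappa_A {d k N : ℕ} {φ : Ed d → ℝ} (x₀ : Ed d) (α : Fin d → ℕ) {p : ℝ}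
    (hp : 1 ≤ p) (x : Ed d) : |∑ n ∈ Finset.range N, lt' d k φ x₀ α n x| ^ p ≤
      (N : ℝ) ^ (p - 1) * ∑ n ∈ Finset.range N, |lt' d k φ x₀ α n x| ^ p := by
  have h := Real.rpow_sum_le_const_mul_sum_rpow (Finset.range N)
    (fun n => lt' d k φ x₀ α n x) hp
  rw [Finset.card_range] at h
  refine le_trans ?_ h
  exact Real.rpow_le_rpow (abs_nonneg _) (Finset.abs_sum_le_sum_abs _ _) (by linarith)

lemma kappa_B {d k N : ℕ} {φ : Ed d → ℝ} (hs : tsupport φ ⊆ closedBall 0 (3 / 4))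
    (x₀ : Ed d) (α : Fin d → ℕ) (h0 : ∀ x, pderivA d α φ x ≠ 0 → 1 / 2 ≤ ‖x‖) {p : ℝ}
    (hp : 0 < p) (x : Ed d) : |∑ n ∈ Finset.range N, lt' d k φ x₀ α n x| ^ p ≤
      1 * ∑ n ∈ Finset.range N, |lt' d k φ x₀ α n x| ^ p := by
  rw [one_mul]
  have hb : ∀ n, lt' d k φ x₀ α n x ≠ 0 →
      1 / 2 ≤ 2 ^ n * ‖x - x₀‖ ∧ 2 ^ n * ‖x - x₀‖ ≤ 3 / 4 := by
    intro n hn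
    have hn' : pderivA d α φ ((2 : ℝ) ^ n • (x - x₀)) ≠ 0 :=
      right_ne_zero_of_mul (right_ne_zero_of_mul hn)
    have h1 := h0 _ hn'
    have h2 := hs (tsupport_pderivA α φ (subset_tsupport _ hn'))
    rw [mem_closedBall_zero_iff] at h2
    rw [norm_smul, Real.norm_of_nonneg (by positivity)] at h1 h2
    exact ⟨h1, h2⟩
  have hlt : ∀ n n', n < n' → lt' d k φ x₀ α n x ≠ 0 → lt' d k φ x₀ α n' x ≠ 0 → False := by
    intro n n' hnn h1 h2
    have b1 := (hb n h1).1
    have b2 := (hb n' h2).2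
    have h3 : (2 : ℝ) ^ (n + 1) ≤ 2 ^ n' := pow_le_pow_right₀ (by norm_num) hnn
    have h4 : (2 : ℝ) ^ (n + 1) * ‖x - x₀‖ ≤ 2 ^ n' * ‖x - x₀‖ := by gcongr
    rw [pow_succ] at h4
    linarith
  by_cases hall : ∀ n ∈ Finset.range N, lt' d k φ x₀ α n x = 0
  · rw [Finset.sum_eq_zero hall, abs_zero, Real.zero_rpow hp.ne']
    positivity
  · push Not at hall
    obtain ⟨n, hn, hne⟩ := hall
    rw [Finset.sum_eq_single_of_mem n hn]
    · exact Finset.single_le_sum (f := fun n => |lt' d k φ x₀ α n x| ^ p)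
        (fun _ _ => by positivity) hn
    · intro b _ hbn
      by_contra hb0
      rcases lt_or_gt_of_ne hbn with h | h
      · exact hlt b n h hb0 hne
      · exact hlt n b h hne hb0

lemma sum_pow_A {e : ℝ} (he : e ≤ -1) (N : ℕ) :
    ∑ n ∈ Finset.range N, ((2 : ℝ) ^ n) ^ e ≤ 2 := by
  calc ∑ n ∈ Finset.range N, ((2 : ℝ) ^ n) ^ e ≤ ∑ n ∈ Finset.range N, (1 / 2 : ℝ) ^ n := by
        apply Finset.sum_le_sum
        intro n _
        calc ((2 : ℝ) ^ n) ^ e ≤ ((2 : ℝ) ^ n) ^ (-1 : ℝ) :=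
              Real.rpow_le_rpow_of_exponent_le (one_le_pow₀ (by norm_num)) he
          _ = _ := by rw [Real.rpow_neg_one, one_div, inv_pow]
    _ ≤ 2 := sum_geometric_two_le N

lemma sum_pow_B {e : ℝ} (he : e ≤ 0) (N : ℕ) :
    ∑ n ∈ Finset.range N, ((2 : ℝ) ^ n) ^ e ≤ N := by
  calc ∑ n ∈ Finset.range N, ((2 : ℝ) ^ n) ^ e ≤ ∑ n ∈ Finset.range N, (1 : ℝ) := by
        apply Finset.sum_le_sum
        intro n _
        exact Real.rpow_le_one_of_one_le_of_nonpos (one_le_pow₀ (by norm_num)) he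
    _ = N := by simp

lemma nec_m_core {d ℓ m m' : ℕ} (hl : ℓ < d) {a a' p c : ℝ} (hp : 1 ≤ p) (hc : 0 < c)
    (hE : Emb d ℓ m m' a a' p c)
    (hm : ∀ b ≤ m, ((b : ℝ) - m') * p - d ≤ -1 ∨ (m' < b ∧ ((b : ℝ) - m') * p - d ≤ 0 ∧ 1 < p)) :
    ∃ K : ℝ, 0 ≤ K ∧ ∀ N : ℕ, 1 ≤ N → (N : ℝ) ^ p ≤
      K * ((N : ℝ) ^ (p - 1) + if 1 < p then (N : ℝ) else 0) := by
  have hp0 : 0 < p := by linarith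
  set i₀ : Fin d := ⟨0, by omega⟩ with hi₀
  set x₀ : Ed d := EuclideanSpace.single i₀ 4 with hx₀
  have hn0 : nrm' d ℓ x₀ = 4 := nrm'_single hl (by norm_num)
  have hrho : ∀ y ∈ closedBall x₀ 1, rhoModel d ℓ y = 1 := by
    intro y hy
    have := nrm'_lip d ℓ y x₀
    rw [mem_closedBall, dist_eq_norm] at hy
    rw [hn0, abs_le] at this
    rw [rho_eq]
    apply min_eq_left
    linarith [this.1]
  have hsub : closedBall x₀ 1 ⊆ ModelDomain d ℓ := fun y hy =>
    mem_model_of_rho (by rw [hrho y hy]; exact one_pos)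
  have hx₀b : x₀ ∈ closedBall x₀ 1 := mem_closedBall_self zero_le_one
  obtain ⟨φ, hφ, hs, ⟨β, hβ, hβ1⟩, hann⟩ := exists_profile i₀ m'
  set I : (Fin d → ℕ) → ℝ := fun α => ∫ x, |pderivA d α φ x| ^ p with hI
  have hI0 : ∀ α, 0 ≤ I α := fun α => integral_nonneg fun x => by positivity
  have hS0 : 0 ≤ ∑ α ∈ multiIdx d m, 2 * I α :=
    Finset.sum_nonneg fun α _ => by have := hI0 α; positivity
  refine ⟨c ^ p * ∑ α ∈ multiIdx d m, 2 * I α, by positivity, ?_⟩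
  intro N hN
  set u := lac d m' N φ x₀ with hu
  have hts := tsupport_lac (k := m') (N := N) hs x₀
  have hus : Smooth d u := by
    unfold Smooth
    rw [hu]
    unfold lac
    exact ContDiff.sum fun n _ => smooth_lac_term hφ x₀ n
  have htest : IsTestFun d (ModelDomain d ℓ) u :=
    ⟨hus, (isCompact_closedBall _ _).of_isClosed_subset isClosed_closure hts, hts.trans hsub⟩
  have hmain := test_ineq hl hp0 hE htest (β := β) (by rw [mem_multiIdx, hβ]) (hsub hx₀b)
  have hval : pderivA d β u x₀ = N := by
    rw [hu, pderivA_lac hφ]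
    simp only [sub_self, smul_zero, hβ1, hβ, mul_one]
    rw [Finset.sum_congr rfl fun n _ => inv_mul_cancel₀ (by positivity)]
    simp
  have hk : ∀ α, ∫ y, kIntegrand d (rhoModel d ℓ) a p α (pderivA d α u) y =
      ∫ y, |pderivA d α u y| ^ p := by
    intro α
    congr 1
    funext y
    unfold kIntegrand
    by_cases h0 : pderivA d α u y = 0
    · simp [h0]
    · rw [hrho y (hts (tsupport_pderivA α u (subset_tsupport _ h0))), Real.one_rpow, one_mul]
  simp_rw [hk] at hmain
  rw [hrho _ hx₀b, Real.one_rpow, one_mul, hval, abs_of_nonneg (Nat.cast_nonneg _)] at hmain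
  set T : ℝ := (N : ℝ) ^ (p - 1) + if 1 < p then (N : ℝ) else 0 with hT
  have hN1 : 0 ≤ (N : ℝ) ^ (p - 1) := by positivity
  have hN2 : 0 ≤ (if 1 < p then (N : ℝ) else 0) := by split_ifs <;> positivity
  have hle : ∑ α ∈ multiIdx d m, ∫ y, |pderivA d α u y| ^ p ≤
      (∑ α ∈ multiIdx d m, 2 * I α) * T := by
    rw [Finset.sum_mul]
    apply Finset.sum_le_sum
    intro α hα
    have hIα := hI0 α
    rcases hm _ (mem_multiIdx.1 hα) with h | ⟨h1, h2, h3⟩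
    · refine (int_lac_le hφ hs x₀ α hp0 (kappa_A x₀ α hp)).trans ?_
      calc _ ≤ (N : ℝ) ^ (p - 1) * (2 * I α) := by
            gcongr
            exact sum_pow_A h N
        _ = 2 * I α * (N : ℝ) ^ (p - 1) := by ring
        _ ≤ _ := by gcongr; linarith
    · refine (int_lac_le hφ hs x₀ α hp0 (kappa_B hs x₀ α (hann α h1) hp0)).trans ?_
      calc _ ≤ 1 * ((N : ℝ) * I α) := by
            gcongr
            exact sum_pow_B h2 N
        _ ≤ 2 * I α * N := by nlinarith [mul_nonneg hIα (Nat.cast_nonneg (α := ℝ) N)]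
        _ ≤ _ := by
            gcongr
            rw [hT, if_pos h3]; linarith
  have hs0 : 0 ≤ ∑ α ∈ multiIdx d m, ∫ y, |pderivA d α u y| ^ p :=
    Finset.sum_nonneg fun α _ => integral_nonneg fun x => by positivity
  calc (N : ℝ) ^ p ≤ (c * (∑ α ∈ multiIdx d m, ∫ y, |pderivA d α u y| ^ p) ^ (1 / p)) ^ p :=
        Real.rpow_le_rpow (by positivity) hmain hp0.le
    _ = c ^ p * ∑ α ∈ multiIdx d m, ∫ y, |pderivA d α u y| ^ p := by
        rw [Real.mul_rpow hc.le (by positivity), ← Real.rpow_mul hs0,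
          one_div_mul_cancel hp0.ne', Real.rpow_one]
    _ ≤ c ^ p * ((∑ α ∈ multiIdx d m, 2 * I α) * T) := by gcongr
    _ = _ := by ring

lemma nec_m_gt {d ℓ m m' : ℕ} (hl : ℓ < d) {a a' p c : ℝ} (hp : 1 < p) (hc : 0 < c)
    (hE : Emb d ℓ m m' a a' p c) : (m' : ℝ) < m - d / p := by
  by_contra hcon
  push Not at hcon
  have hp0 : 0 < p := by linarith
  have hd1 : (1 : ℝ) ≤ d := by exact_mod_cast (by omega : 1 ≤ d)
  obtain ⟨K, hK, h⟩ := nec_m_core hl hp.le hc hE (by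
    intro b hb
    by_cases hbm : b ≤ m'
    · left
      have : (b : ℝ) ≤ m' := by exact_mod_cast hbm
      nlinarith
    · right
      refine ⟨by omega, ?_, hp⟩
      have hb' : (b : ℝ) ≤ m := by exact_mod_cast hb
      have : (b : ℝ) - m' ≤ d / p := by linarith
      rw [le_div_iff₀ hp0] at this
      linarith)
  simp only [hp, if_true] at h
  have l1 : Tendsto (fun N : ℕ => (N : ℝ)) atTop atTop := tendsto_natCast_atTop_atTop
  have l2 : Tendsto (fun N : ℕ => (N : ℝ) ^ (p - 1)) atTop atTop :=
    (tendsto_rpow_atTop (by linarith)).comp l1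
  obtain ⟨N, ⟨hN1, hN2⟩, hN3⟩ := (((l1.eventually_gt_atTop (2 * K)).and
    (l2.eventually_gt_atTop (2 * K))).and (eventually_ge_atTop 1)).exists
  have hN := h N hN3
  have hN0 : (0 : ℝ) < N := by exact_mod_cast hN3
  have e : (N : ℝ) ^ p = N * (N : ℝ) ^ (p - 1) := by
    rw [Real.rpow_sub hN0, Real.rpow_one]; field_simp
  have hq : 0 < (N : ℝ) ^ (p - 1) := by positivity
  rw [e] at hN
  nlinarith

lemma nec_m_one {d ℓ m m' : ℕ} (hl : ℓ < d) {a a' c : ℝ} (hc : 0 < c)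
    (hE : Emb d ℓ m m' a a' 1 c) : (m' : ℝ) ≤ m - d := by
  by_contra hcon
  have hlt : m < m' + d := by
    push Not at hcon
    exact_mod_cast (by linarith : (m : ℝ) < m' + d)
  obtain ⟨K, hK, h⟩ := nec_m_core hl le_rfl hc hE (by
    intro b hb
    left
    have : (b : ℝ) + 1 ≤ m' + d := by exact_mod_cast (by omega : b + 1 ≤ m' + d)
    linarith)
  simp only [lt_irrefl, if_false, sub_self, Real.rpow_zero, Real.rpow_one, add_zero, mul_one] at h
  obtain ⟨N, hN⟩ := exists_nat_gt (max K 1)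
  have h1 : (1 : ℝ) < N := lt_of_le_of_lt (le_max_right _ _) hN
  have h2 := h N (by exact_mod_cast h1.le)
  linarith [le_max_left K 1]


/-- Continuous embeddings into `𝒦^{m'}_{a',∞}(ℝ^d, ℝ^ℓ_*)` in the model case:
(i) for `1 < p < ∞` the embedding `𝒦^m_{a,p} ↪ 𝒦^{m'}_{a',∞}` holds iff
`m - d/p > m'` and `a - d/p ≥ a'`; (ii) for `p = 1` it holds iff
`m - d ≥ m'` and `a - d ≥ a'`. -/
theorem statement5 (d ℓ : ℕ) (hd : 2 ≤ d) (hl : ℓ < d) (m m' : ℕ) (hm : 1 ≤ m)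
    (a a' : ℝ) :
    (∀ p : ℝ, 1 < p →
      ((∃ c : ℝ, 0 < c ∧ ∀ u : Ed d → ℝ, MemKM d ℓ m a p u →
          MemKMInf d ℓ m' a' u ∧ KnormMInf d ℓ m' a' u ≤ c * KnormM d ℓ m a p u) ↔
        ((m' : ℝ) < (m : ℝ) - d / p ∧ a' ≤ a - d / p))) ∧
    ((∃ c : ℝ, 0 < c ∧ ∀ u : Ed d → ℝ, MemKM d ℓ m a 1 u →
        MemKMInf d ℓ m' a' u ∧ KnormMInf d ℓ m' a' u ≤ c * KnormM d ℓ m a 1 u) ↔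
      ((m' : ℝ) ≤ (m : ℝ) - d ∧ a' ≤ a - d)) := by
  refine ⟨fun p hp => ⟨?_, ?_⟩, ⟨?_, ?_⟩⟩
  · rintro ⟨c, hc, hE⟩
    exact ⟨nec_m_gt hl hp hc hE, nec_a hl (by linarith) hE⟩
  · rintro ⟨h1, h2⟩
    exact suff_gt hl hp h2 h1
  · rintro ⟨c, hc, hE⟩
    exact ⟨nec_m_one hl hc hE, by simpa using nec_a hl one_pos hE⟩
  · rintro ⟨h1, h2⟩
    exact suff_one hl h2 h1

end
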